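/- arXiv:1706.00126 — 8 statements merged into one kernel-verified Lean document; each statement's English description precedes it below -/
import Mathlib

section
/- Let I be a monomial ideal of R and let I = I_1 ∩ … ∩ I_m be its (unique, irredundant) irreducible decomposition. Then I_1, …, I_m are exactly the minimal irreducible monomial ideals of I, i.e., every minimal irreducible monomial ideal of I equals some I_j, and each I_j is a minimal irreducible monomial ideal of I. -/
open MvPolynomial

noncomputable section

/-- A monomial ideal of `K[x_1, …, x_n]`: an ideal generated by monomials. -/
def IsMonomialIdeal {n : ℕ} {K : Type*} [Field K] (I : Ideal (MvPolynomial (Fin n) K)) : Prop :=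
  ∃ S : Set (Fin n →₀ ℕ), I = Ideal.span ((fun a => monomial a (1 : K)) '' S)

/-- An irreducible monomial ideal: an ideal of the form `(x_{i₁}^{a₁}, …, x_{i_r}^{a_r})`
with all exponents `a_j ≥ 1`. -/
def IsIrreducibleMonomialIdeal {n : ℕ} {K : Type*} [Field K]
    (L : Ideal (MvPolynomial (Fin n) K)) : Prop :=
  ∃ (s : Finset (Fin n)) (a : Fin n → ℕ), (∀ i ∈ s, 1 ≤ a i) ∧
    L = Ideal.span ((fun i => (X i : MvPolynomial (Fin n) K) ^ a i) '' ↑s)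

/-- `L` is a minimal irreducible monomial ideal of `I`: `L` is an irreducible monomial ideal
containing `I`, and every irreducible monomial ideal squeezed between `I` and `L` equals `L`. -/
def IsMinimalIrreducibleOf {n : ℕ} {K : Type*} [Field K]
    (I L : Ideal (MvPolynomial (Fin n) K)) : Prop :=
  IsIrreducibleMonomialIdeal L ∧ I ≤ L ∧
    ∀ L' : Ideal (MvPolynomial (Fin n) K),
      IsIrreducibleMonomialIdeal L' → I ≤ L' → L' ≤ L → L' = L

/-- A monomial lies in `(x_i ^ a i : i ∈ s)` iff it is divisible by one of the generators. -/
theorem monomial_mem_span_X_pow_iff {σ R : Type*} [CommSemiring R] [Nontrivial R]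
    {s : Set σ} {a : σ → ℕ} {e : σ →₀ ℕ} :
    monomial e (1 : R) ∈ Ideal.span ((fun i => (X i : MvPolynomial σ R) ^ a i) '' s) ↔
      ∃ i ∈ s, a i ≤ e i := by
  classical
  have h : (fun i => (X i : MvPolynomial σ R) ^ a i) '' s =
      (fun d => monomial d (1 : R)) '' ((fun i => Finsupp.single i (a i)) '' s) := by
    rw [Set.image_image]
    simp only [X_pow_eq_monomial]
  rw [h, mem_ideal_span_monomial_image]
  simp [support_monomial]

/-- Irreducible monomial ideals are prime with respect to finite intersections of irreducible
monomial ideals. -/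
theorem IsIrreducibleMonomialIdeal.exists_le_of_iInf_le {n : ℕ} {K : Type*} [Field K]
    {ι : Type*} [Finite ι] {c : ι → Ideal (MvPolynomial (Fin n) K)}
    (hc : ∀ j, IsIrreducibleMonomialIdeal (c j)) {L : Ideal (MvPolynomial (Fin n) K)}
    (hL : IsIrreducibleMonomialIdeal L) (h : ⨅ j, c j ≤ L) : ∃ j, c j ≤ L := by
  cases nonempty_fintype ι
  by_contra! hne
  have hgen : ∀ j, ∃ (i : Fin n) (d : ℕ), (∀ e : Fin n →₀ ℕ, d ≤ e i →
      monomial e (1 : K) ∈ c j) ∧ monomial (Finsupp.single i d) (1 : K) ∉ L := by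
    intro j
    obtain ⟨s, a, -, hs⟩ := hc j
    obtain ⟨i, hi, hiL⟩ : ∃ i ∈ s, (X i : MvPolynomial (Fin n) K) ^ a i ∉ L := by
      by_contra! hall
      refine hne j ?_
      rw [hs, Ideal.span_le]
      rintro _ ⟨i, hi, rfl⟩
      exact hall i hi
    refine ⟨i, a i, fun e he => ?_, by rwa [← X_pow_eq_monomial]⟩
    rw [hs, monomial_mem_span_X_pow_iff]
    exact ⟨i, hi, he⟩
  choose i d hmem hnot using hgen
  let e : Fin n →₀ ℕ := Finsupp.equivFunOnFinite.symm
    fun k => Finset.univ.sup fun j => Finsupp.single (i j) (d j) k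
  have he : ∀ k, e k = Finset.univ.sup fun j => Finsupp.single (i j) (d j) k := fun _ => rfl
  have heL : monomial e (1 : K) ∈ L := by
    refine h ((Submodule.mem_iInf _).2 fun j => hmem j e ?_)
    rw [he]
    simpa using Finset.le_sup (f := fun l => Finsupp.single (i l) (d l) (i j))
      (Finset.mem_univ j)
  obtain ⟨t, b, hb, rfl⟩ := hL
  obtain ⟨k, hk, hbk⟩ := monomial_mem_span_X_pow_iff.1 heL
  rw [he, Finset.le_sup_iff (hb k hk)] at hbk
  obtain ⟨j, -, hj⟩ := hbk
  exact hnot j (monomial_mem_span_X_pow_iff.2 ⟨k, hk, hj⟩)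

/-- If `I = I₁ ∩ ⋯ ∩ Iₘ` is the (irredundant) irreducible decomposition of
a monomial ideal `I`, then `I₁, …, Iₘ` are exactly the minimal irreducible monomial ideals
of `I`. -/
theorem irreducibleComponents_eq_minimalIrreducibles
    {n : ℕ} {K : Type*} [Field K] (I : Ideal (MvPolynomial (Fin n) K))
    (hI : IsMonomialIdeal I) (m : ℕ) (c : Fin m → Ideal (MvPolynomial (Fin n) K))
    (hirr : ∀ j, IsIrreducibleMonomialIdeal (c j))
    (hdec : I = ⨅ j, c j)
    (hirred : ∀ j : Fin m, I ≠ ⨅ i ∈ Finset.univ.erase j, c i) :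
    ∀ L : Ideal (MvPolynomial (Fin n) K),
      IsMinimalIrreducibleOf I L ↔ ∃ j, L = c j := by
  intro L
  have hle : ∀ j, I ≤ c j := fun j => hdec.trans_le (iInf_le c j)
  constructor
  · rintro ⟨hL, hIL, hmin⟩
    obtain ⟨j, hj⟩ := hL.exists_le_of_iInf_le hirr (hdec ▸ hIL)
    exact ⟨j, (hmin (c j) (hirr j) (hle j) hj).symm⟩
  · rintro ⟨j, rfl⟩
    refine ⟨hirr j, hle j, fun L' hL' hIL' hL'j => le_antisymm hL'j ?_⟩
    obtain ⟨k, hk⟩ := hL'.exists_le_of_iInf_le hirr (hdec ▸ hIL')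
    by_cases hkj : k = j
    · exact hkj ▸ hk
    · refine absurd (le_antisymm (le_iInf₂ fun l _ => hle l) ?_) (hirred j)
      rw [hdec]
      refine le_iInf fun l => ?_
      by_cases hlj : l = j
      · subst hlj
        exact (iInf₂_le k (by simp [hkj])).trans (hk.trans hL'j)
      · exact iInf₂_le l (by simp [hlj])
end
end

section
/- Let I be a monomial ideal of R with minimal monomial generating set G(I) = {x^{v_1},…,x^{v_r}}, where v_i = (v_{i1},…,v_{in}), and let I = I_1 ∩ … ∩ I_m be its irreducible decomposition. Then the set {x_j^{v_{ij}} : 1 ≤ i ≤ r, 1 ≤ j ≤ n, v_{ij} ≥ 1} of pure powers of variables occurring in the minimal generators of I is equal to G(I_1) ∪ … ∪ G(I_m). -/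
open MvPolynomial

noncomputable section

/-- `u` lists the (unique) minimal monomial generating set `G(J)` of the monomial ideal `J`:
the monomials `x^{u i}` generate `J` and none of them is redundant. -/
def IsMinimalMonomialGens {n : ℕ} {K : Type*} [Field K] (J : Ideal (MvPolynomial (Fin n) K))
    {s : ℕ} (u : Fin s → (Fin n →₀ ℕ)) : Prop :=
  J = Ideal.span (Set.range fun i => monomial (u i) (1 : K)) ∧
    ∀ i : Fin s, monomial (u i) (1 : K) ∉
      Ideal.span ((fun i' => monomial (u i') (1 : K)) '' {i' | i' ≠ i})

/-- Membership in an ideal generated by powers of variables can be read off the support. -/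
lemma mem_span_X_pow_image_iff {n : ℕ} {K : Type*} [Field K] (t : Set (Fin n)) (b : Fin n → ℕ)
    (f : MvPolynomial (Fin n) K) :
    f ∈ Ideal.span ((fun i => (X i : MvPolynomial (Fin n) K) ^ b i) '' t) ↔
      ∀ u ∈ f.support, ∃ j ∈ t, b j ≤ u j := by
  have h : (fun i => (X i : MvPolynomial (Fin n) K) ^ b i) '' t =
      (fun e => monomial e (1 : K)) '' ((fun i => Finsupp.single i (b i)) '' t) := by
    simp only [Set.image_image, X_pow_eq_monomial]
  rw [h, mem_ideal_span_monomial_image]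
  simp only [Set.exists_mem_image, Finsupp.single_le_iff]

/-- Membership in a finitely generated monomial ideal can be read off the support. -/
lemma mem_span_image_monomial_iff {n : ℕ} {K : Type*} [Field K] {r : ℕ}
    (v : Fin r → (Fin n →₀ ℕ)) (t : Set (Fin r)) (f : MvPolynomial (Fin n) K) :
    f ∈ Ideal.span ((fun i => monomial (v i) (1 : K)) '' t) ↔
      ∀ u ∈ f.support, ∃ i ∈ t, v i ≤ u := by
  have h : (fun i => monomial (v i) (1 : K)) '' t = (fun e => monomial e (1 : K)) '' (v '' t) := by
    simp only [Set.image_image]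
  rw [h, mem_ideal_span_monomial_image]
  simp only [Set.exists_mem_image]

/-- A variable exponent of a minimal generator occurs as an exponent in some component. -/
lemma exists_component_exponent_eq {n m : ℕ} {ι : Type*} (v : ι → (Fin n →₀ ℕ))
    (s : Fin m → Finset (Fin n)) (a : Fin m → Fin n → ℕ)
    (hmem : ∀ u : Fin n →₀ ℕ, (∃ i, v i ≤ u) ↔ ∀ k, ∃ j ∈ s k, a k j ≤ u j)
    (hmin : ∀ i i', v i' ≤ v i → i' = i) {i : ι} {j : Fin n} (hij : 1 ≤ v i j) :
    ∃ k, j ∈ s k ∧ a k j = v i j := by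
  have hnot : ¬ ∃ i', v i' ≤ (v i).update j (v i j - 1) := by
    rintro ⟨i', hi'⟩
    have hle : v i' ≤ v i := by
      refine hi'.trans fun l => ?_
      by_cases hl : l = j
      · subst hl; simp
      · simp [Finsupp.update_apply, hl]
    have := hi' j
    rw [hmin i i' hle] at this
    simp at this
    omega
  rw [hmem] at hnot
  push Not at hnot
  obtain ⟨k, hk⟩ := hnot
  obtain ⟨l, hl, hle⟩ := (hmem (v i)).1 ⟨i, le_rfl⟩ k
  have hlt := hk l hl
  by_cases hlj : l = j
  · subst hlj
    refine ⟨k, hl, ?_⟩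
    simp at hlt
    omega
  · simp [Finsupp.update_apply, hlj] at hlt
    omega

/-- An exponent of an irredundant component occurs as a variable exponent of some generator. -/
lemma exists_generator_exponent_eq {n m : ℕ} {ι : Type*} (v : ι → (Fin n →₀ ℕ))
    (s : Fin m → Finset (Fin n)) (a : Fin m → Fin n → ℕ)
    (hmem : ∀ u : Fin n →₀ ℕ, (∃ i, v i ≤ u) ↔ ∀ k, ∃ j ∈ s k, a k j ≤ u j)
    {k : Fin m} {u : Fin n →₀ ℕ} (hu : ∀ k', k' ≠ k → ∃ j ∈ s k', a k' j ≤ u j)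
    (huk : ∀ j ∈ s k, u j < a k j) {j : Fin n} (hj : j ∈ s k) :
    ∃ i, v i j = a k j := by
  have hlt := huk j hj
  obtain ⟨i, hi⟩ : ∃ i, v i ≤ u.update j (a k j) := by
    rw [hmem]
    intro k'
    by_cases hk : k' = k
    · subst hk
      exact ⟨j, hj, by simp⟩
    · obtain ⟨l, hl, hle⟩ := hu k' hk
      refine ⟨l, hl, hle.trans ?_⟩
      by_cases hlj : l = j
      · subst hlj; simpa using hlt.le
      · simp [Finsupp.update_apply, hlj]
  refine ⟨i, le_antisymm (by simpa using hi j) ?_⟩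
  by_contra! hvlt
  have hle : v i ≤ u.update j (a k j - 1) := by
    intro l
    by_cases hlj : l = j
    · subst hlj; simp; omega
    · simpa [Finsupp.update_apply, hlj] using hi l
  obtain ⟨l, hl, hle'⟩ := (hmem _).1 ⟨i, hle⟩ k
  have := huk l hl
  by_cases hlj : l = j
  · subst hlj
    simp at hle'
    omega
  · simp [Finsupp.update_apply, hlj] at hle'
    omega

/-- Let `I` be a monomial ideal with minimal generating set
`G(I) = {x^{v₁}, …, x^{v_r}}` and irreducible decomposition `I = I₁ ∩ ⋯ ∩ Iₘ`, where
`I_k = ({x_i^{a_k i} : i ∈ s_k})`. Then the set of pure powers of variables occurring in the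
minimal generators of `I` equals `G(I₁) ∪ ⋯ ∪ G(Iₘ)`. -/
theorem pure_powers_of_minimal_generators_eq_union_of_component_generators
    {n : ℕ} {K : Type*} [Field K] (I : Ideal (MvPolynomial (Fin n) K))
    (hI : IsMonomialIdeal I)
    {r : ℕ} (v : Fin r → (Fin n →₀ ℕ)) (hgen : IsMinimalMonomialGens I v)
    (m : ℕ) (s : Fin m → Finset (Fin n)) (a : Fin m → Fin n → ℕ)
    (hpos : ∀ k, ∀ i ∈ s k, 1 ≤ a k i)
    (hdec : I = ⨅ k : Fin m,
      Ideal.span ((fun i => (X i : MvPolynomial (Fin n) K) ^ a k i) '' ↑(s k)))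
    (hirred : ∀ j : Fin m, I ≠ ⨅ k ∈ Finset.univ.erase j,
      Ideal.span ((fun i => (X i : MvPolynomial (Fin n) K) ^ a k i) '' ↑(s k))) :
    {p : MvPolynomial (Fin n) K | ∃ i j, 1 ≤ v i j ∧ p = (X j : MvPolynomial (Fin n) K) ^ v i j}
      = ⋃ k : Fin m, (fun i => (X i : MvPolynomial (Fin n) K) ^ a k i) '' ↑(s k) := by
  obtain ⟨hspan, hmin⟩ := hgen
  rw [← Set.image_univ] at hspan
  have hmem (u : Fin n →₀ ℕ) : (∃ i, v i ≤ u) ↔ ∀ k, ∃ j ∈ s k, a k j ≤ u j := by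
    have h₁ : monomial u (1 : K) ∈ I ↔ ∃ i, v i ≤ u := by
      rw [hspan, mem_span_image_monomial_iff]
      simp
    have h₂ : monomial u (1 : K) ∈ I ↔ ∀ k, ∃ j ∈ s k, a k j ≤ u j := by
      rw [hdec, Ideal.mem_iInf]
      simp [mem_span_X_pow_image_iff]
    exact h₁.symm.trans h₂
  have hmin' (i i' : Fin r) (hle : v i' ≤ v i) : i' = i := by
    by_contra hne
    refine hmin i ((mem_span_image_monomial_iff v _ _).2 fun u hu => ⟨i', hne, ?_⟩)
    obtain rfl : v i = u := by simpa [support_monomial, eq_comm] using hu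
    exact hle
  have hwit (k : Fin m) : ∃ u : Fin n →₀ ℕ,
      (∀ k', k' ≠ k → ∃ j ∈ s k', a k' j ≤ u j) ∧ ∀ j ∈ s k, u j < a k j := by
    by_contra! hno
    refine hirred k (le_antisymm ?_ fun f hf => ?_)
    · rw [hdec]
      exact le_iInf₂ fun k' _ => iInf_le _ k'
    · simp only [Ideal.mem_iInf, mem_span_X_pow_image_iff, Finset.mem_erase, Finset.mem_univ,
        and_true, Finset.mem_coe] at hf
      rw [hdec, Ideal.mem_iInf]
      intro k'
      rw [mem_span_X_pow_image_iff]
      intro u hu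
      by_cases hk : k' = k
      · subst hk
        exact hno u fun k'' hk'' => hf k'' hk'' u hu
      · exact hf k' hk u hu
  ext p
  simp only [Set.mem_ofPred_eq, Set.mem_iUnion, Set.mem_image, Finset.mem_coe]
  constructor
  · rintro ⟨i, j, hij, rfl⟩
    obtain ⟨k, hj, hk⟩ := exists_component_exponent_eq v s a hmem hmin' hij
    exact ⟨k, j, hj, by rw [hk]⟩
  · rintro ⟨k, j, hj, rfl⟩
    obtain ⟨u, hu, huk⟩ := hwit k
    obtain ⟨i, hi⟩ := exists_generator_exponent_eq v s a hmem hu huk hj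
    exact ⟨i, j, hi ▸ hpos k j hj, by rw [hi]⟩
end
end

section
/- Let I ⊂ R be a monomial ideal and let I = 𝕀_1 ∩ … ∩ 𝕀_r ∩ … ∩ 𝕀_m be an irredundant minimal primary decomposition of I, where 𝕀_1,…,𝕀_r are the primary components associated to the minimal primes of I. Then for every integer k ≥ 1, the k-th symbolic power satisfies I^(k) = 𝕀_1^k ∩ … ∩ 𝕀_r^k. -/
open MvPolynomial

noncomputable section

open Classical in
/-- The contraction to `A` of the extension of `J` in the localization of `A`
at the prime `p`, i.e. `J A_p ∩ A`. -/
def localizedContraction {A : Type*} [CommRing A] (J p : Ideal A) : Ideal A :=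
  if h : p.IsPrime then
    letI := h
    (Ideal.map (algebraMap A (Localization.AtPrime p)) J).comap
      (algebraMap A (Localization.AtPrime p))
  else J

/-- The `k`-th symbolic power of `I`: the intersection of the contractions
`I^k A_p ∩ A` over the minimal primes `p` of `I`. -/
def symbolicPower {A : Type*} [CommRing A] (I : Ideal A) (k : ℕ) : Ideal A :=
  ⨅ p ∈ I.minimalPrimes, localizedContraction (I ^ k) p

/-- The ideal `J` is generated by monomials in the variables indexed by `S`. -/
def IsMonomialIdealIn {σ R : Type*} [CommSemiring R] (S : Set σ)
    (J : Ideal (MvPolynomial σ R)) : Prop :=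
  ∃ A : Set (σ →₀ ℕ), (∀ a ∈ A, ∀ i ∉ S, a i = 0) ∧
    J = Ideal.span ((fun a => monomial a (1 : R)) '' A)

section MonomialIdeal

variable {σ R : Type*} [CommSemiring R] {S : Set σ}

theorem isMonomialIdealIn_span_X_image :
    IsMonomialIdealIn S (Ideal.span (X '' S : Set (MvPolynomial σ R))) := by
  classical
  refine ⟨(fun i => Finsupp.single i 1) '' S, ?_, ?_⟩
  · rintro _ ⟨j, hj, rfl⟩ i hi
    exact Finsupp.single_eq_of_ne fun h => hi (h ▸ hj)
  · rw [Set.image_image]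
    rfl

theorem IsMonomialIdealIn.mul {I J : Ideal (MvPolynomial σ R)} (hI : IsMonomialIdealIn S I)
    (hJ : IsMonomialIdealIn S J) : IsMonomialIdealIn S (I * J) := by
  obtain ⟨A, hA, rfl⟩ := hI
  obtain ⟨B, hB, rfl⟩ := hJ
  refine ⟨Set.image2 (· + ·) A B, ?_, ?_⟩
  · rintro _ ⟨a, ha, b, hb, rfl⟩ i hi
    simp [hA a ha i hi, hB b hb i hi]
  · rw [Ideal.span_mul_span', ← Set.image2_mul, Set.image2_image_left, Set.image2_image_right,
      Set.image_image2]
    simp [monomial_mul]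

theorem IsMonomialIdealIn.pow {J : Ideal (MvPolynomial σ R)} (hJ : IsMonomialIdealIn S J)
    (k : ℕ) : IsMonomialIdealIn S (J ^ k) := by
  induction k with
  | zero => exact ⟨{0}, by simp, by simp [← MvPolynomial.C_apply]⟩
  | succ k ih => exact pow_succ J k ▸ ih.mul hJ

/-- A polynomial outside the ideal generated by the variables in `S` is a nonzerodivisor modulo
any ideal generated by monomials in those variables. -/
theorem IsMonomialIdealIn.mem_of_mul_mem [NoZeroDivisors R] {J : Ideal (MvPolynomial σ R)}
    (hJ : IsMonomialIdealIn S J) {s f : MvPolynomial σ R}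
    (hs : s ∉ Ideal.span (X '' S : Set (MvPolynomial σ R))) (h : s * f ∈ J) : f ∈ J := by
  classical
  obtain ⟨A, hA, rfl⟩ := hJ
  rw [mem_ideal_span_X_image] at hs
  push Not at hs
  obtain ⟨e, he, heS⟩ := hs
  by_contra hf
  rw [mem_ideal_span_monomial_image] at hf h
  push Not at hf
  let d : (σ →₀ ℕ) → ℕ := fun u => (u.filter (· ∈ S)).degree
  have d_add (u v) : d (u + v) = d u + d v := by simp [d, Finsupp.filter_add]
  have d_zero {u} : d u = 0 ↔ ∀ i ∈ S, u i = 0 := by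
    simp [d, Finsupp.degree_eq_zero_iff, Finsupp.filter_eq_zero_iff]
  let bad := f.support.filter fun c => ∀ a ∈ A, ¬ a ≤ c
  have hbad : bad.Nonempty := by
    obtain ⟨c, hc, hcA⟩ := hf
    exact ⟨c, Finset.mem_filter.2 ⟨hc, hcA⟩⟩
  obtain ⟨c₀, hc₀, hmin⟩ := bad.exists_min_image d hbad
  have hs₀ : (s.support.filter fun u => d u = 0).Nonempty :=
    ⟨e, Finset.mem_filter.2 ⟨he, d_zero.2 heS⟩⟩
  have hf₀ : (bad.filter fun u => d u = d c₀).Nonempty :=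
    ⟨c₀, Finset.mem_filter.2 ⟨hc₀, rfl⟩⟩
  obtain ⟨b, hb, c, hc, huniq⟩ := UniqueSums.uniqueAdd_of_nonempty hs₀ hf₀
  simp only [Finset.mem_filter] at hb hc
  have not_le {a} (ha : a ∈ A) : ¬ a ≤ b + c := by
    intro hle
    refine (Finset.mem_filter.1 hc.1).2 a ha fun i => ?_
    by_cases hi : i ∈ S
    · simpa [d_zero.1 hb.2 i hi] using hle i
    · simp [hA a ha i hi]
  have huniq' : UniqueAdd s.support f.support b c := by
    intro b' c' hb' hc' heq
    have hc'bad : c' ∈ bad := Finset.mem_filter.2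
      ⟨hc', fun a ha hle => not_le ha (heq ▸ hle.trans le_add_self)⟩
    have hd := congrArg d heq
    rw [d_add, d_add] at hd
    have := hmin c' hc'bad
    exact huniq (Finset.mem_filter.2 ⟨hb', by omega⟩)
      (Finset.mem_filter.2 ⟨hc'bad, by omega⟩) heq
  have hcoeff : coeff (b + c) (s * f) = coeff b s * coeff c f :=
    AddMonoidAlgebra.coeff_mul_add_of_uniqueAdd huniq'
  have hmem : b + c ∈ (s * f).support := by
    rw [mem_support_iff, hcoeff]
    exact mul_ne_zero (mem_support_iff.1 hb.1)
      (mem_support_iff.1 (Finset.mem_filter.1 hc.1).1)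
  obtain ⟨a, ha, hle⟩ := h _ hmem
  exact not_le ha hle

end MonomialIdeal

theorem isPrime_span_X_image {σ R : Type*} [CommRing R] [IsDomain R] (S : Set σ) :
    (Ideal.span (X '' S : Set (MvPolynomial σ R))).IsPrime := by
  refine ⟨?_, fun {s f} h => ?_⟩
  · rw [Ideal.ne_top_iff_one, mem_ideal_span_X_image]
    intro h
    obtain ⟨i, -, hi⟩ := h 0 (by simp)
    exact hi rfl
  · by_contra! hsf
    exact hsf.2 (isMonomialIdealIn_span_X_image.mem_of_mul_mem hsf.1 h)

/-- A prime ideal containing a monomial contains one of the variables occurring in it. -/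
theorem exists_X_mem_of_monomial_mem {σ R : Type*} [CommRing R]
    {p : Ideal (MvPolynomial σ R)} (hp : p.IsPrime) {a : σ →₀ ℕ}
    (ha : monomial a (1 : R) ∈ p) : ∃ i, a i ≠ 0 ∧ X i ∈ p := by
  rw [monomial_eq, C_1, one_mul, Finsupp.prod, hp.prod_mem_iff] at ha
  obtain ⟨i, hi, h⟩ := ha
  exact ⟨i, Finsupp.mem_support_iff.1 hi, hp.mem_of_pow_mem _ h⟩

theorem eq_span_X_of_mem_minimalPrimes {σ R : Type*} [CommRing R] [IsDomain R] {A : Set (σ →₀ ℕ)}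
    {p : Ideal (MvPolynomial σ R)}
    (hp : p ∈ (Ideal.span ((fun a => monomial a (1 : R)) '' A)).minimalPrimes) :
    p = Ideal.span (X '' {i | X i ∈ p}) := by
  have hle : Ideal.span (X '' {i | X i ∈ p}) ≤ p := by
    rw [Ideal.span_le]
    rintro _ ⟨i, hi, rfl⟩
    exact hi
  refine le_antisymm (hp.2 ⟨isPrime_span_X_image _, ?_⟩ hle) hle
  rw [Ideal.span_le]
  rintro _ ⟨a, ha, rfl⟩
  obtain ⟨i, hi, hip⟩ := exists_X_mem_of_monomial_mem hp.1.1
    (hp.1.2 (Ideal.subset_span ⟨a, ha, rfl⟩))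
  refine mem_ideal_span_X_image.2 fun u hu => ⟨i, hip, ?_⟩
  rwa [Finset.mem_singleton.1 (support_monomial_subset hu)]

/-- If `Q` is an ideal which is primary for a minimal prime `p` of a monomial ideal `I` and agrees
with `I` locally at `p`, then `Q` is generated by monomials in the variables lying in `p`. -/
theorem isMonomialIdealIn_of_isPrimary {σ R : Type*} [CommRing R] [IsDomain R]
    {A : Set (σ →₀ ℕ)} {Q : Ideal (MvPolynomial σ R)} (hQ : Q.IsPrimary)
    (hAQ : Ideal.span ((fun a => monomial a (1 : R)) '' A) ≤ Q)
    (hp : Q.radical = Ideal.span (X '' {i | X i ∈ Q.radical}))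
    {s : MvPolynomial σ R} (hs : s ∉ Q.radical)
    (hsQ : ∀ f ∈ Q, s * f ∈ Ideal.span ((fun a => monomial a (1 : R)) '' A)) :
    IsMonomialIdealIn {i | X i ∈ Q.radical} Q := by
  classical
  set S : Set σ := {i | X i ∈ Q.radical}
  have key : IsMonomialIdealIn S (Ideal.span ((fun a => monomial a (1 : R)) ''
      ((fun a => a.filter (· ∈ S)) '' A))) := by
    refine ⟨_, ?_, rfl⟩
    rintro _ ⟨a, -, rfl⟩ i hi
    exact Finsupp.filter_apply_neg _ _ hi
  suffices h : Q = Ideal.span ((fun a => monomial a (1 : R)) ''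
      ((fun a => a.filter (· ∈ S)) '' A)) from h ▸ key
  refine le_antisymm (fun f hf => key.mem_of_mul_mem (hp ▸ hs) (Ideal.span_le.2 ?_ (hsQ f hf))) ?_
  · rintro _ ⟨a, ha, rfl⟩
    refine mem_ideal_span_monomial_image.2 fun u hu => ⟨_, ⟨a, ha, rfl⟩, ?_⟩
    rw [Finset.mem_singleton.1 (support_monomial_subset hu)]
    intro i
    by_cases hi : i ∈ S <;> simp [hi]
  · rw [Ideal.span_le]
    rintro _ ⟨_, ⟨a, ha, rfl⟩, rfl⟩
    have hmem : monomial (a.filter (· ∈ S)) (1 : R) * monomial (a.filter (· ∉ S)) 1 ∈ Q := by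
      rw [monomial_mul, Finsupp.filter_add_filter_not, one_mul]
      exact hAQ (Ideal.subset_span ⟨a, ha, rfl⟩)
    refine ((Ideal.isPrimary_iff.1 hQ).2 hmem).resolve_right fun h => ?_
    obtain ⟨i, hi, hiQ⟩ := exists_X_mem_of_monomial_mem (Ideal.isPrime_radical hQ) h
    exact hi (Finsupp.filter_apply_neg _ _ (not_not.2 hiQ))

theorem mem_localizedContraction_iff {A : Type*} [CommRing A] {J p : Ideal A} (hp : p.IsPrime)
    {x : A} : x ∈ localizedContraction J p ↔ ∃ s ∉ p, s * x ∈ J := by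
  rw [localizedContraction, dif_pos hp, Ideal.mem_comap,
    IsLocalization.algebraMap_mem_map_algebraMap_iff p.primeCompl]
  rfl

/-- A component of a finite intersection with minimal radical agrees with the intersection
after multiplying by some element outside that radical. -/
theorem exists_notMem_forall_mul_mem_iInf {A ι : Type*} [CommRing A] [Finite ι]
    {Q : ι → Ideal A} (hprim : ∀ i, (Q i).IsPrimary)
    (hinj : Function.Injective fun i => (Q i).radical) {i : ι}
    (hi : (Q i).radical ∈ (⨅ j, Q j).minimalPrimes) :
    ∃ s ∉ (Q i).radical, ∀ f ∈ Q i, s * f ∈ ⨅ j, Q j := by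
  classical
  cases nonempty_fintype ι
  have hnot : ¬ (Finset.univ.erase i).inf Q ≤ (Q i).radical := by
    rw [hi.1.1.inf_le']
    rintro ⟨j, hj, hle⟩
    have hrad : (Q j).radical ≤ (Q i).radical := hi.1.1.radical_le_iff.2 hle
    exact Finset.ne_of_mem_erase hj <| hinj <| le_antisymm hrad <|
      hi.2 ⟨Ideal.isPrime_radical (hprim j), (iInf_le Q j).trans Ideal.le_radical⟩ hrad
  obtain ⟨s, hs, hsi⟩ := SetLike.not_le_iff_exists.1 hnot
  refine ⟨s, hsi, fun f hf => Ideal.mem_iInf.2 fun j => ?_⟩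
  by_cases hji : j = i
  · exact hji ▸ Ideal.mul_mem_left _ _ hf
  · exact Ideal.mul_mem_right _ _
      (Finset.inf_le (f := Q) (Finset.mem_erase.2 ⟨hji, Finset.mem_univ j⟩) hs)

/-- Every minimal prime of a finite intersection of primary ideals is the radical of one
of them. -/
theorem exists_radical_eq_of_mem_minimalPrimes_iInf {A ι : Type*} [CommRing A] [Finite ι]
    {Q : ι → Ideal A} (hprim : ∀ i, (Q i).IsPrimary) {p : Ideal A}
    (hp : p ∈ (⨅ j, Q j).minimalPrimes) : ∃ i, (Q i).radical = p := by
  cases nonempty_fintype ι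
  have hle : Finset.univ.inf Q ≤ p := by
    rw [Finset.inf_univ_eq_iInf]
    exact hp.1.2
  obtain ⟨i, -, hi⟩ := hp.1.1.inf_le'.1 hle
  have hrad : (Q i).radical ≤ p := hp.1.1.radical_le_iff.2 hi
  exact ⟨i, le_antisymm hrad <|
    hp.2 ⟨Ideal.isPrime_radical (hprim i), (iInf_le Q i).trans Ideal.le_radical⟩ hrad⟩

/-- If `I = Q₁ ∩ ⋯ ∩ Q_r ∩ ⋯ ∩ Qₘ` is an irredundant minimal primary
decomposition of a monomial ideal `I`, where `Q₁, …, Q_r` are the primary components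
associated to the minimal primes of `I`, then `I^{(k)} = Q₁^k ∩ ⋯ ∩ Q_r^k` for `k ≥ 1`. -/
theorem symbolicPower_eq_inf_pow_of_primary_decomposition
    {n : ℕ} {K : Type*} [Field K] (I : Ideal (MvPolynomial (Fin n) K))
    (hI : IsMonomialIdeal I)
    (m r : ℕ) (Q : Fin m → Ideal (MvPolynomial (Fin n) K))
    (hprim : ∀ i, (Q i).IsPrimary)
    (hdec : I = ⨅ i, Q i)
    (hirred : ∀ j : Fin m, I ≠ ⨅ i ∈ Finset.univ.erase j, Q i)
    (hminimal : Function.Injective fun i => (Q i).radical)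
    (hrm : r ≤ m)
    (hminpr : ∀ i : Fin m, (i : ℕ) < r ↔ (Q i).radical ∈ I.minimalPrimes) :
    ∀ k : ℕ, 1 ≤ k →
      symbolicPower I k = ⨅ i : Fin m, ⨅ _ : (i : ℕ) < r, (Q i) ^ k := by
  intro k _
  obtain ⟨A, hA⟩ := hI
  have hcomp (i : Fin m) (hi : (Q i).radical ∈ I.minimalPrimes) :
      localizedContraction (I ^ k) (Q i).radical = Q i ^ k := by
    obtain ⟨s, hs, hsQ⟩ := exists_notMem_forall_mul_mem_iInf hprim hminimal (hdec ▸ hi)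
    rw [← hdec] at hsQ
    have hIQ : I ≤ Q i := hdec.trans_le (iInf_le Q i)
    have hrad := eq_span_X_of_mem_minimalPrimes (hA ▸ hi)
    have hmon := (isMonomialIdealIn_of_isPrimary (hprim i) (hA ▸ hIQ) hrad hs (hA ▸ hsQ)).pow k
    ext f
    rw [mem_localizedContraction_iff hi.1.1]
    constructor
    · rintro ⟨t, ht, htf⟩
      exact hmon.mem_of_mul_mem (hrad ▸ ht) (Ideal.pow_right_mono hIQ k htf)
    · intro hf
      refine ⟨s ^ k, fun h => hs (hi.1.1.mem_of_pow_mem k h), ?_⟩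
      have hle : Ideal.span {s} * Q i ≤ I := Ideal.span_singleton_mul_le_iff.2 hsQ
      refine Ideal.pow_right_mono hle k ?_
      rw [mul_pow, Ideal.span_singleton_pow]
      exact Ideal.mul_mem_mul (Ideal.mem_span_singleton_self _) hf
  apply le_antisymm
  · refine le_iInf₂ fun i hi => ?_
    rw [← hcomp i ((hminpr i).1 hi)]
    exact iInf₂_le _ ((hminpr i).1 hi)
  · refine le_iInf₂ fun p hp => ?_
    obtain ⟨i, rfl⟩ := exists_radical_eq_of_mem_minimalPrimes_iInf hprim (hdec ▸ hp)
    rw [hcomp i hp]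
    exact iInf₂_le i ((hminpr i).2 hp)
end
end

section
/- If 𝔮 ⊂ R is a monomial ideal that is primary with radical p, then 𝔮^k is a p-primary ideal for every integer k ≥ 1. -/
open MvPolynomial

noncomputable section

/-- If `h` involves no variable of `T` and `I` is generated by monomials in the variables of `T`,
then `h` is a nonzerodivisor modulo `I`. -/
theorem mem_of_mul_mem_span_monomial {σ R : Type*} [CommRing R] [IsDomain R]
    (m : MonomialOrder σ) {T : Set σ} {S : Set (σ →₀ ℕ)} (hS : ∀ s ∈ S, ∀ i ∉ T, s i = 0)
    {f h : MvPolynomial σ R} (hh : h ≠ 0) (hhT : ∀ d ∈ h.support, ∀ i ∈ T, d i = 0)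
    (hfh : f * h ∈ Ideal.span ((fun a => monomial a (1 : R)) '' S)) :
    f ∈ Ideal.span ((fun a => monomial a (1 : R)) '' S) := by
  classical
  set I := Ideal.span ((fun a => monomial a (1 : R)) '' S)
  let U : Set (σ →₀ ℕ) := {d | ∃ s ∈ S, s ≤ d}
  have hmem (x : MvPolynomial σ R) : x ∈ I ↔ ∀ d ∈ x.support, d ∈ U :=
    mem_ideal_span_monomial_image
  let f₁ : MvPolynomial σ R := ∑ d ∈ f.support with d ∈ U, monomial d (coeff d f)
  let f₂ : MvPolynomial σ R := ∑ d ∈ f.support with d ∉ U, monomial d (coeff d f)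
  have hf : f₁ + f₂ = f := by
    rw [Finset.sum_filter_add_sum_filter_not, support_sum_monomial_coeff]
  have hf₁ : f₁ ∈ I := by
    refine Ideal.sum_mem _ fun d hd => (hmem _).2 fun e he => ?_
    rw [Finset.mem_singleton.1 (support_monomial_subset he)]
    exact (Finset.mem_filter.1 hd).2
  have hf₂ : ∀ d ∈ f₂.support, d ∉ U := fun d hd => by
    obtain ⟨e, he, hde⟩ := Finset.mem_biUnion.1 (support_sum hd)
    rw [Finset.mem_singleton.1 (support_monomial_subset hde)]
    exact (Finset.mem_filter.1 he).2
  by_cases h₂ : f₂ = 0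
  · rwa [← hf, h₂, add_zero]
  have hf₂h : f₂ * h ∈ I := by
    rw [← hf, add_mul] at hfh
    exact (Ideal.add_mem_iff_right _ (I.mul_mem_right h hf₁)).1 hfh
  obtain ⟨s, hs, hle⟩ := (hmem _).1 hf₂h _ (m.degree_mem_support (mul_ne_zero h₂ hh))
  refine absurd ⟨s, hs, fun i => ?_⟩ (hf₂ _ (m.degree_mem_support h₂))
  by_cases hi : i ∈ T
  · have := hle i
    rwa [m.degree_mul h₂ hh, Finsupp.add_apply, hhT _ (m.degree_mem_support hh) i hi,
      add_zero] at this
  · simp [hS s hs i hi]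

/-- An ideal generated by monomials in the variables of `T` is primary as soon as it is proper and
its radical contains the variables of `T`. -/
theorem isPrimary_span_monomial {σ R : Type*} [CommRing R] [IsDomain R]
    (m : MonomialOrder σ) {T : Set σ} {S : Set (σ →₀ ℕ)} (hS : ∀ s ∈ S, ∀ i ∉ T, s i = 0)
    (htop : Ideal.span ((fun a => monomial a (1 : R)) '' S) ≠ ⊤)
    (hT : ∀ i ∈ T, X i ∈ (Ideal.span ((fun a => monomial a (1 : R)) '' S)).radical) :
    (Ideal.span ((fun a => monomial a (1 : R)) '' S)).IsPrimary := by
  classical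
  refine Ideal.isPrimary_iff.2 ⟨htop, fun {f g} hfg => ?_⟩
  set I := Ideal.span ((fun a => monomial a (1 : R)) '' S)
  let g₀ : MvPolynomial σ R := ∑ d ∈ g.support with ∀ i ∈ T, d i = 0, monomial d (coeff d g)
  let g₁ : MvPolynomial σ R := ∑ d ∈ g.support with ¬ ∀ i ∈ T, d i = 0, monomial d (coeff d g)
  have hg : g₀ + g₁ = g := by
    rw [Finset.sum_filter_add_sum_filter_not, support_sum_monomial_coeff]
  have hg₁ : g₁ ∈ I.radical := by
    refine Ideal.sum_mem _ fun d hd => ?_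
    obtain ⟨i, hi, hdi⟩ : ∃ i ∈ T, d i ≠ 0 := by simpa using (Finset.mem_filter.1 hd).2
    exact Ideal.mem_of_dvd _ (X_dvd_monomial.2 (.inr hdi)) (hT i hi)
  have hg₀ : g₀ ∈ supported R Tᶜ := by
    refine Subalgebra.sum_mem _ fun d hd => mem_supported.2 fun i hi hiT => ?_
    obtain ⟨e, he, hie⟩ := (mem_vars_iff_mem_support i).1 hi
    rw [Finset.mem_singleton.1 (support_monomial_subset he)] at hie
    exact Finsupp.mem_support_iff.1 hie ((Finset.mem_filter.1 hd).2 i hiT)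
  by_cases h₀ : g₀ = 0
  · exact .inr (by rwa [← hg, h₀, zero_add])
  obtain ⟨N, hN⟩ := hg₁
  refine .inl (mem_of_mul_mem_span_monomial m hS (h := (-g₀) ^ N)
    (pow_ne_zero _ (neg_ne_zero.2 h₀)) (fun d hd i hi => ?_) ?_)
  · by_contra hdi
    exact mem_supported.1 (Subalgebra.pow_mem _ (Subalgebra.neg_mem _ hg₀) N)
      ((mem_vars_iff_mem_support i).2 ⟨d, hd, Finsupp.mem_support_iff.2 hdi⟩) hi
  · have hdvd : f * g ∣ f * (g₁ ^ N - (-g₀) ^ N) := by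
      refine mul_dvd_mul_left f ?_
      rw [← hg, add_comm, ← sub_neg_eq_add]
      exact sub_dvd_pow_sub_pow _ _ N
    have := I.sub_mem (I.mul_mem_left f hN) (Ideal.mem_of_dvd _ hdvd hfg)
    rwa [← mul_sub, sub_sub_cancel] at this

/-- A primary monomial ideal is generated by monomials in the variables of its radical. -/
theorem exists_span_monomial_of_isPrimary {σ R : Type*} [CommRing R] {S : Set (σ →₀ ℕ)}
    (hq : (Ideal.span ((fun a => monomial a (1 : R)) '' S)).IsPrimary) :
    ∃ S' : Set (σ →₀ ℕ),
      (∀ s ∈ S', ∀ i, X i ∉ (Ideal.span ((fun a => monomial a (1 : R)) '' S)).radical → s i = 0) ∧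
      Ideal.span ((fun a => monomial a (1 : R)) '' S) =
        Ideal.span ((fun a => monomial a (1 : R)) '' S') := by
  classical
  set q := Ideal.span ((fun a => monomial a (1 : R)) '' S)
  have := Ideal.isPrime_radical hq
  refine ⟨{s | monomial s (1 : R) ∈ q ∧ ∀ i, X i ∉ q.radical → s i = 0},
    fun s hs => hs.2, le_antisymm (Ideal.span_le.2 ?_) (Ideal.span_le.2 ?_)⟩
  · rintro _ ⟨a, ha, rfl⟩
    let b := a.filter fun i => X i ∈ q.radical
    let c := a.filter fun i => ¬ X i ∈ q.radical
    have hbc : monomial b (1 : R) * monomial c 1 = monomial a 1 := by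
      rw [monomial_mul, one_mul, Finsupp.filter_add_filter_not]
    have hb : monomial b (1 : R) ∈ q := by
      have hbcq : monomial b (1 : R) * monomial c 1 ∈ q := hbc ▸ Ideal.subset_span ⟨a, ha, rfl⟩
      refine ((Ideal.isPrimary_iff.1 hq).2 hbcq).resolve_right fun hc => ?_
      rw [monomial_eq, map_one, one_mul, Finsupp.prod, Ideal.IsPrime.prod_mem_iff] at hc
      obtain ⟨i, hi, hic⟩ := hc
      rw [Finsupp.support_filter, Finset.mem_filter] at hi
      exact hi.2 (Ideal.IsPrime.mem_of_pow_mem this _ hic)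
    change monomial a (1 : R) ∈ _
    rw [← hbc]
    exact Ideal.mul_mem_right _ _
      (Ideal.subset_span ⟨b, ⟨hb, fun i hi => Finsupp.filter_apply_neg _ _ hi⟩, rfl⟩)
  · rintro _ ⟨s, hs, rfl⟩
    exact hs.1

open scoped Pointwise in
/-- Powers of an ideal generated by monomials in the variables of `T` are generated by
monomials in the variables of `T`. -/
theorem exists_span_monomial_pow {σ R : Type*} [CommRing R] {T : Set σ} {S : Set (σ →₀ ℕ)}
    (hS : ∀ s ∈ S, ∀ i ∉ T, s i = 0) (k : ℕ) :
    ∃ S' : Set (σ →₀ ℕ), (∀ s ∈ S', ∀ i ∉ T, s i = 0) ∧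
      Ideal.span ((fun a => monomial a (1 : R)) '' S) ^ k =
        Ideal.span ((fun a => monomial a (1 : R)) '' S') := by
  induction k with
  | zero => exact ⟨{0}, by simp, by simp [Ideal.one_eq_top]⟩
  | succ k ih =>
    obtain ⟨S', hS', h⟩ := ih
    refine ⟨Set.image2 (· + ·) S' S, ?_, ?_⟩
    · rintro _ ⟨a, ha, b, hb, rfl⟩ i hi
      simp [hS' a ha i hi, hS b hb i hi]
    · rw [pow_succ, h, Ideal.span_mul_span', ← Set.image2_mul, Set.image2_image_left,
        Set.image2_image_right, Set.image_image2]
      simp only [monomial_mul, one_mul]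

/-- If `q` is a monomial ideal that is primary with radical `p`, then `q^k`
is `p`-primary for every `k ≥ 1`. -/
theorem pow_isPrimary_of_monomial_isPrimary
    {n : ℕ} {K : Type*} [Field K] (q p : Ideal (MvPolynomial (Fin n) K))
    (hmon : IsMonomialIdeal q) (hq : q.IsPrimary) (hp : p.IsPrime) (hrad : q.radical = p) :
    ∀ k : ℕ, 1 ≤ k → (q ^ k).IsPrimary ∧ (q ^ k).radical = p := by
  intro k hk
  have hrk : (q ^ k).radical = p := by rw [Ideal.radical_pow _ (by omega), hrad]
  refine ⟨?_, hrk⟩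
  have htop : q ^ k ≠ ⊤ := fun h => hp.ne_top (by rw [← hrk, h, Ideal.radical_top])
  obtain ⟨S, rfl⟩ := hmon
  obtain ⟨S₁, hS₁, h₁⟩ := exists_span_monomial_of_isPrimary hq
  rw [hrad] at hS₁
  obtain ⟨S₂, hS₂, h₂⟩ := exists_span_monomial_pow (R := K) (T := {i | X i ∈ p}) hS₁ k
  rw [h₁, h₂] at htop hrk ⊢
  exact isPrimary_span_monomial MonomialOrder.lex hS₂ htop fun i hi => hrk ▸ hi
end
end

section
/- Let D be a vertex-weighted oriented graph with underlying graph G and let Υ(D) be the set of all strong vertex covers of D. Then the irreducible decomposition of the edge ideal I(D) is I(D) = ∩_{C ∈ Υ(D)} I_C, where I_C is the irreducible monomial ideal generated by the variables in L_1(C) together with the pure powers x_i^{d_i} for x_i ∈ L_2(C) ∪ L_3(C). -/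
open MvPolynomial

noncomputable section

/-- A vertex-weighted oriented graph on the vertex set `{x_1, …, x_n}`: a digraph with no
loops and no oriented cycles of length two, together with a positive integer weight `d i`
attached to each vertex. -/
structure WOG (n : ℕ) where
  E : Fin n → Fin n → Prop
  irrefl : ∀ i, ¬ E i i
  no_two_cycles : ∀ i j, E i j → ¬ E j i
  d : Fin n → ℕ
  dpos : ∀ i, 1 ≤ d i

/-- The edge ideal `I(D) = (x_i x_j^{d_j} : (x_i, x_j) ∈ E(D))` of a vertex-weighted
oriented graph `D`. -/
def edgeIdeal (K : Type*) [Field K] {n : ℕ} (D : WOG n) : Ideal (MvPolynomial (Fin n) K) :=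
  Ideal.span {f | ∃ i j, D.E i j ∧ f = X i * (X j : MvPolynomial (Fin n) K) ^ D.d j}

/-- `C` is a vertex cover of (the underlying graph of) `D`. -/
def WOG.IsVertexCover {n : ℕ} (D : WOG n) (C : Set (Fin n)) : Prop :=
  ∀ i j, D.E i j → i ∈ C ∨ j ∈ C

/-- `C` is a minimal vertex cover of (the underlying graph of) `D`. -/
def WOG.IsMinimalVertexCover {n : ℕ} (D : WOG n) (C : Set (Fin n)) : Prop :=
  D.IsVertexCover C ∧ ∀ C' ⊆ C, D.IsVertexCover C' → C' = C

/-- `L_1(C)`: the vertices `x ∈ C` with an arrow `(x, y) ∈ E(D)` leaving `C`. -/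
def WOG.L1 {n : ℕ} (D : WOG n) (C : Set (Fin n)) : Set (Fin n) :=
  {i | i ∈ C ∧ ∃ j, D.E i j ∧ j ∉ C}

/-- `L_3(C)`: the vertices `x ∈ C` all of whose neighbours (in the underlying graph)
lie in `C`. -/
def WOG.L3 {n : ℕ} (D : WOG n) (C : Set (Fin n)) : Set (Fin n) :=
  {i | i ∈ C ∧ ∀ j, (D.E i j ∨ D.E j i) → j ∈ C}

/-- `L_2(C) = C \ (L_1(C) ∪ L_3(C))`. -/
def WOG.L2 {n : ℕ} (D : WOG n) (C : Set (Fin n)) : Set (Fin n) :=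
  C \ (D.L1 C ∪ D.L3 C)

/-- `C` is a strong vertex cover of `D`. -/
def WOG.IsStrongVertexCover {n : ℕ} (D : WOG n) (C : Set (Fin n)) : Prop :=
  D.IsVertexCover C ∧ (D.IsMinimalVertexCover C ∨
    ∀ i ∈ D.L3 C, ∃ j, D.E j i ∧ j ∈ D.L2 C ∪ D.L3 C ∧ 2 ≤ D.d j)

/-- The irreducible monomial ideal
`I_C = (L_1(C) ∪ {x_i^{d_i} : x_i ∈ L_2(C) ∪ L_3(C)})` attached to a vertex cover `C`. -/
def coverIdeal (K : Type*) [Field K] {n : ℕ} (D : WOG n) (C : Set (Fin n)) :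
    Ideal (MvPolynomial (Fin n) K) :=
  Ideal.span ({f | ∃ i ∈ D.L1 C, f = (X i : MvPolynomial (Fin n) K)} ∪
    {f | ∃ i ∈ D.L2 C ∪ D.L3 C, f = (X i : MvPolynomial (Fin n) K) ^ D.d i})

theorem MvPolynomial.mem_ideal_span_X_pow_image {σ R : Type*} [CommSemiring R]
    (a : σ → ℕ) (S : Set σ) (p : MvPolynomial σ R) :
    p ∈ Ideal.span ((fun i => (X i : MvPolynomial σ R) ^ a i) '' S) ↔
      ∀ m ∈ p.support, ∃ i ∈ S, a i ≤ m i := by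
  have h : (fun i => (X i : MvPolynomial σ R) ^ a i) '' S =
      (fun m => monomial m (1 : R)) '' ((fun i => Finsupp.single i (a i)) '' S) := by
    simp only [Set.image_image, X_pow_eq_monomial]
  simp [h, mem_ideal_span_monomial_image]

theorem mem_edgeIdeal {n : ℕ} {K : Type*} [Field K] (D : WOG n)
    (p : MvPolynomial (Fin n) K) :
    p ∈ edgeIdeal K D ↔ ∀ m ∈ p.support, ∃ i j, D.E i j ∧ 1 ≤ m i ∧ D.d j ≤ m j := by
  have h : {f | ∃ i j, D.E i j ∧ f = X i * (X j : MvPolynomial (Fin n) K) ^ D.d j} =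
      (fun m => monomial m (1 : K)) ''
        {m | ∃ i j, D.E i j ∧ m = Finsupp.single i 1 + Finsupp.single j (D.d j)} := by
    ext f
    simp only [Set.mem_ofPred_eq, Set.mem_image]
    constructor
    · rintro ⟨i, j, hij, rfl⟩
      exact ⟨_, ⟨i, j, hij, rfl⟩, by rw [X_pow_eq_monomial, X, monomial_mul, one_mul]⟩
    · rintro ⟨_, ⟨i, j, hij, rfl⟩, rfl⟩
      exact ⟨i, j, hij, by rw [X_pow_eq_monomial, X, monomial_mul, one_mul]⟩
  rw [edgeIdeal, h, mem_ideal_span_monomial_image]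
  refine forall₂_congr fun m _ => ?_
  constructor
  · rintro ⟨_, ⟨i, j, hij, rfl⟩, hm⟩
    have hi := hm i
    have hj := hm j
    simp only [Finsupp.add_apply, Finsupp.single_eq_same] at hi hj
    exact ⟨i, j, hij, by omega, by omega⟩
  · rintro ⟨i, j, hij, hi, hj⟩
    refine ⟨_, ⟨i, j, hij, rfl⟩, fun k => ?_⟩
    have hne : i ≠ j := fun h => D.irrefl j (h ▸ hij)
    rw [Finsupp.add_apply, Finsupp.single_apply, Finsupp.single_apply]
    split_ifs with h₁ h₂ h₂
    · exact absurd (h₁.trans h₂.symm) hne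
    · simpa [← h₁] using hi
    · simpa [← h₂] using hj
    · simp

namespace WOG

variable {n : ℕ} (D : WOG n)

open Classical in
/-- The exponent of `x_i` in the generator of `I_C` attached to the vertex `x_i ∈ C`. -/
def coverExponent (C : Set (Fin n)) (i : Fin n) : ℕ :=
  if i ∈ D.L1 C then 1 else D.d i

theorem coverExponent_of_mem {C : Set (Fin n)} {i : Fin n} (h : i ∈ D.L1 C) :
    D.coverExponent C i = 1 := if_pos h

theorem coverExponent_of_notMem {C : Set (Fin n)} {i : Fin n} (h : i ∉ D.L1 C) :
    D.coverExponent C i = D.d i := if_neg h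

theorem one_le_coverExponent (C : Set (Fin n)) (i : Fin n) : 1 ≤ D.coverExponent C i := by
  unfold coverExponent
  split_ifs
  exacts [le_rfl, D.dpos i]

theorem coverExponent_le (C : Set (Fin n)) (i : Fin n) : D.coverExponent C i ≤ D.d i := by
  unfold coverExponent
  split_ifs
  exacts [D.dpos i, le_rfl]

theorem mem_L2_union_L3 {C : Set (Fin n)} {i : Fin n} :
    i ∈ D.L2 C ∪ D.L3 C ↔ i ∈ C ∧ i ∉ D.L1 C := by
  simp only [L1, L2, L3, Set.mem_union, Set.mem_sdiff, Set.mem_ofPred_eq]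
  grind

theorem coverIdeal_eq_span (K : Type*) [Field K] (C : Set (Fin n)) :
    coverIdeal K D C =
      Ideal.span ((fun i => (X i : MvPolynomial (Fin n) K) ^ D.coverExponent C i) '' C) := by
  rw [coverIdeal]
  congr 1
  ext f
  simp only [mem_L2_union_L3, Set.mem_image]
  constructor
  · rintro (⟨i, hi, rfl⟩ | ⟨i, ⟨hi, hi'⟩, rfl⟩)
    · exact ⟨i, hi.1, by rw [D.coverExponent_of_mem hi, pow_one]⟩
    · exact ⟨i, hi, by rw [D.coverExponent_of_notMem hi']⟩
  · rintro ⟨i, hi, rfl⟩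
    by_cases h : i ∈ D.L1 C
    · exact .inl ⟨i, h, by rw [D.coverExponent_of_mem h, pow_one]⟩
    · exact .inr ⟨i, ⟨hi, h⟩, by rw [D.coverExponent_of_notMem h]⟩

theorem mem_coverIdeal {K : Type*} [Field K] (C : Set (Fin n))
    (p : MvPolynomial (Fin n) K) :
    p ∈ coverIdeal K D C ↔ ∀ m ∈ p.support, ∃ i ∈ C, D.coverExponent C i ≤ m i := by
  rw [coverIdeal_eq_span, mem_ideal_span_X_pow_image]

theorem isIrreducibleMonomialIdeal_coverIdeal (K : Type*) [Field K] (C : Set (Fin n)) :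
    IsIrreducibleMonomialIdeal (coverIdeal K D C) := by
  classical
  refine ⟨C.toFinset, D.coverExponent C, fun i _ => D.one_le_coverExponent C i, ?_⟩
  rw [Set.coe_toFinset, coverIdeal_eq_span]

variable {D}

theorem IsVertexCover.edgeIdeal_le_coverIdeal (K : Type*) [Field K] {C : Set (Fin n)}
    (hC : D.IsVertexCover C) : edgeIdeal K D ≤ coverIdeal K D C := by
  intro p hp
  rw [mem_edgeIdeal] at hp
  rw [mem_coverIdeal]
  intro m hm
  obtain ⟨i, j, hij, hi, hj⟩ := hp m hm
  by_cases hjC : j ∈ C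
  · exact ⟨j, hjC, (D.coverExponent_le C j).trans hj⟩
  · have hiC := (hC i j hij).resolve_right hjC
    exact ⟨i, hiC, (D.coverExponent_of_mem ⟨hiC, j, hij, hjC⟩).trans_le hi⟩

theorem IsVertexCover.sdiff_singleton {C : Set (Fin n)} (hC : D.IsVertexCover C)
    {x : Fin n} (hx : x ∈ D.L3 C) : D.IsVertexCover (C \ {x}) := by
  intro i j hij
  have hne : i ≠ j := fun h => D.irrefl j (h ▸ hij)
  have h₁ := hC i j hij
  have h₂ := hx.2
  simp only [Set.mem_sdiff, Set.mem_singleton_iff]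
  grind

theorem IsStrongVertexCover.exists_edge {C : Set (Fin n)} (hC : D.IsStrongVertexCover C)
    {x : Fin n} (hx : x ∈ D.L3 C) : ∃ y, D.E y x ∧ y ∈ C ∧ y ∉ D.L1 C ∧ 2 ≤ D.d y := by
  rcases hC.2 with hmin | h
  · have h := hmin.2 _ Set.sdiff_subset (hC.1.sdiff_singleton hx)
    exact absurd (h.symm ▸ hx.1 : x ∈ C \ {x}) (by simp)
  · obtain ⟨y, hyx, hy, hd⟩ := h x hx
    rw [mem_L2_union_L3] at hy
    exact ⟨y, hyx, hy.1, hy.2, hd⟩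

/-- A monomial outside the edge ideal lies outside `I_C` for some strong vertex cover `C`. -/
theorem exists_isStrongVertexCover_lt_coverExponent (m : Fin n → ℕ)
    (hm : ∀ i j, D.E i j → 1 ≤ m i → m j < D.d j) :
    ∃ C, D.IsStrongVertexCover C ∧ ∀ i ∈ C, m i < D.coverExponent C i := by
  let P : Set (Fin n) → Prop := fun C =>
    D.IsVertexCover C ∧ ∀ i ∈ C, m i < D.coverExponent C i
  have hP : P {i | m i < D.d i} := by
    constructor
    · intro i j hij
      have := hm i j hij
      have := D.dpos i
      simp only [Set.mem_ofPred_eq]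
      omega
    · intro i hi
      by_cases h : i ∈ D.L1 {i | m i < D.d i}
      · rw [D.coverExponent_of_mem h]
        obtain ⟨-, j, hij, hj⟩ := h
        by_contra h0
        exact hj (hm i j hij (by omega))
      · rwa [D.coverExponent_of_notMem h]
  obtain ⟨C, hC⟩ := (Set.toFinite {C | P C}).exists_minimal ⟨_, hP⟩
  refine ⟨C, ⟨hC.prop.1, .inr fun x hx => ?_⟩, hC.prop.2⟩
  by_contra! hbad
  have hP' : P (C \ {x}) := by
    refine ⟨hC.prop.1.sdiff_singleton hx, fun i hi => ?_⟩
    have hmi := hC.prop.2 i hi.1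
    by_cases h : i ∈ D.L1 (C \ {x})
    · rw [D.coverExponent_of_mem h]
      by_cases hiC : i ∈ D.L1 C
      · rwa [D.coverExponent_of_mem hiC] at hmi
      · obtain ⟨-, j, hij, hj⟩ := h
        have hjx : j = x := by
          by_contra hne
          exact hiC ⟨hi.1, j, hij, fun hjC => hj ⟨hjC, hne⟩⟩
        have := hbad i (hjx ▸ hij) (D.mem_L2_union_L3.2 ⟨hi.1, hiC⟩)
        rw [D.coverExponent_of_notMem hiC] at hmi
        omega
    · rw [D.coverExponent_of_notMem h]
      exact hmi.trans_le (D.coverExponent_le C i)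
  exact (hC.le_of_le hP' Set.sdiff_subset hx.1).2 rfl

theorem edgeIdeal_eq_iInf_coverIdeal (K : Type*) [Field K] (D : WOG n) :
    edgeIdeal K D = ⨅ C ∈ {C : Set (Fin n) | D.IsStrongVertexCover C}, coverIdeal K D C := by
  refine le_antisymm (le_iInf₂ fun C hC => hC.1.edgeIdeal_le_coverIdeal K) fun p hp => ?_
  simp only [Submodule.mem_iInf, mem_coverIdeal, Set.mem_ofPred_eq] at hp
  rw [mem_edgeIdeal]
  intro m hm
  by_contra! hbad
  obtain ⟨C, hC, h⟩ := exists_isStrongVertexCover_lt_coverExponent m hbad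
  obtain ⟨i, hi, hle⟩ := hp C hC m hm
  exact (h i hi).not_ge hle

open Classical in
/-- The exponent vector of a monomial which, among the ideals of strong vertex covers,
avoids only `I_C`. -/
def separatingExponent (D : WOG n) (C : Set (Fin n)) : Fin n →₀ ℕ :=
  Finsupp.equivFunOnFinite.symm fun i => if i ∈ C then D.coverExponent C i - 1 else D.d i

theorem separatingExponent_of_mem {C : Set (Fin n)} {i : Fin n} (h : i ∈ C) :
    D.separatingExponent C i = D.coverExponent C i - 1 := by
  simp [separatingExponent, h]

theorem separatingExponent_of_notMem {C : Set (Fin n)} {i : Fin n} (h : i ∉ C) :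
    D.separatingExponent C i = D.d i := by
  simp [separatingExponent, h]

theorem separatingExponent_lt {C : Set (Fin n)} {i : Fin n} (h : i ∈ C) :
    D.separatingExponent C i < D.coverExponent C i := by
  have := D.one_le_coverExponent C i
  rw [separatingExponent_of_mem h]
  omega

theorem IsStrongVertexCover.eq_of_separatingExponent_lt {C C' : Set (Fin n)}
    (hC : D.IsStrongVertexCover C) (hC' : D.IsVertexCover C')
    (h : ∀ i ∈ C', D.separatingExponent C i < D.coverExponent C' i) : C' = C := by
  have hsub : C' ⊆ C := fun i hi => by
    by_contra hiC
    have h₁ := h i hi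
    rw [separatingExponent_of_notMem hiC] at h₁
    exact h₁.not_ge (D.coverExponent_le C' i)
  refine hsub.antisymm fun z hz => ?_
  by_contra hzC'
  have hz3 : z ∈ D.L3 C := by
    refine ⟨hz, fun j hj => hsub ?_⟩
    rcases hj with hj | hj
    · exact (hC' z j hj).resolve_left hzC'
    · exact (hC' j z hj).resolve_right hzC'
  obtain ⟨y, hyz, hyC, hy, hd⟩ := hC.exists_edge hz3
  have hyC' := (hC' y z hyz).resolve_right hzC'
  have hlt := h y hyC'
  rw [separatingExponent_of_mem hyC, D.coverExponent_of_notMem hy,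
    D.coverExponent_of_mem ⟨hyC', z, hyz, hzC'⟩] at hlt
  omega

theorem IsStrongVertexCover.edgeIdeal_ne_iInf (K : Type*) [Field K] {C : Set (Fin n)}
    (hC : D.IsStrongVertexCover C) :
    edgeIdeal K D ≠
      ⨅ C' ∈ {C' : Set (Fin n) | D.IsStrongVertexCover C' ∧ C' ≠ C}, coverIdeal K D C' := by
  intro heq
  have hmem : monomial (D.separatingExponent C) (1 : K) ∈ edgeIdeal K D := by
    rw [heq]
    simp only [Submodule.mem_iInf, mem_coverIdeal, Set.mem_ofPred_eq]
    rintro C' ⟨hC', hne⟩ m hm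
    obtain rfl := Finset.mem_singleton.1 (support_monomial_subset hm)
    by_contra! h
    exact hne (hC.eq_of_separatingExponent_lt hC'.1 h)
  have hcov := hC.1.edgeIdeal_le_coverIdeal K hmem
  rw [mem_coverIdeal] at hcov
  obtain ⟨i, hi, hle⟩ := hcov (D.separatingExponent C) (by simp)
  exact (separatingExponent_lt hi).not_ge hle

end WOG

/-- The irreducible decomposition of the edge ideal of a vertex-weighted
oriented graph `D` is `I(D) = ⋂_{C ∈ Υ(D)} I_C`, the (irredundant) intersection of the
irreducible ideals `I_C` over all strong vertex covers `C` of `D`. -/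
theorem edgeIdeal_irreducible_decomposition
    {n : ℕ} (K : Type*) [Field K] (D : WOG n) :
    edgeIdeal K D = (⨅ C ∈ {C : Set (Fin n) | D.IsStrongVertexCover C}, coverIdeal K D C) ∧
      (∀ C : Set (Fin n), D.IsStrongVertexCover C →
        IsIrreducibleMonomialIdeal (coverIdeal K D C)) ∧
      (∀ C : Set (Fin n), D.IsStrongVertexCover C →
        edgeIdeal K D ≠
          ⨅ C' ∈ {C' : Set (Fin n) | D.IsStrongVertexCover C' ∧ C' ≠ C},
            coverIdeal K D C') := by
  exact ⟨WOG.edgeIdeal_eq_iInf_coverIdeal K D,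
    fun C _ => D.isIrreducibleMonomialIdeal_coverIdeal K C,
    fun _ hC => hC.edgeIdeal_ne_iInf K⟩
end
end

section
/- Let I ⊂ R be a monomial ideal, fix a variable x_i occurring in G(I), let q be the maximum degree in x_i of the monomials of G(I), let B_i = {x^a ∈ G(I) : deg_{x_i}(x^a) = q}, A_i = G(I) \ B_i, p = max{deg_{x_i}(x^a) : x^a ∈ A_i}, and L = ({x^a/x_i : x^a ∈ B_i} ∪ A_i). If p ≥ 1 and q − p ≥ 2, then depth(R/I) = depth(R/L). -/
open MvPolynomial

noncomputable section

open RingTheory.Sequence in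
/-- The depth of `R/I` (with respect to the irrelevant maximal ideal `(x_1, …, x_n)`):
the supremum of the lengths of regular sequences on `R/I` contained in `(x_1, …, x_n)`. -/
def gradedDepth {n : ℕ} {K : Type*} [Field K] (I : Ideal (MvPolynomial (Fin n) K)) : ℕ∞ :=
  sSup {k : ℕ∞ | ∃ rs : List (MvPolynomial (Fin n) K),
    (∀ f ∈ rs, f ∈ Ideal.span (Set.range (X : Fin n → MvPolynomial (Fin n) K))) ∧
    IsRegular (MvPolynomial (Fin n) K ⧸ I) rs ∧ k = rs.length}

/-- `HasRegularChain m k I` says that `A ⧸ I` admits a weakly regular sequence of length `k`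
whose elements lie in `m`. -/
def HasRegularChain {A : Type*} [CommRing A] (m : Ideal A) : ℕ → Ideal A → Prop
  | 0, _ => True
  | k + 1, I => ∃ x ∈ m, (∀ a, x * a ∈ I → a ∈ I) ∧ HasRegularChain m k (I ⊔ Ideal.span {x})

lemma mem_of_mul_mem_sup_span_swap {A : Type*} [CommRing A] {I : Ideal A} {x z : A}
    (hx : ∀ a, x * a ∈ I → a ∈ I)
    (hzx : ∀ a, z * a ∈ I ⊔ Ideal.span {x} → a ∈ I ⊔ Ideal.span {x})
    (a : A) (ha : x * a ∈ I ⊔ Ideal.span {z}) : a ∈ I ⊔ Ideal.span {z} := by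
  obtain ⟨j, hj, w, hw, h⟩ := Submodule.mem_sup.1 ha
  obtain ⟨b, rfl⟩ := Ideal.mem_span_singleton'.1 hw
  have hb : b ∈ I ⊔ Ideal.span {x} := by
    apply hzx
    have : z * b = x * a - j := by linear_combination h
    rw [this]
    exact sub_mem (Ideal.mul_mem_right _ _ (Ideal.mem_sup_right (Ideal.mem_span_singleton_self x)))
      (Ideal.mem_sup_left hj)
  obtain ⟨j', hj', w', hw', h'⟩ := Submodule.mem_sup.1 hb
  obtain ⟨c, rfl⟩ := Ideal.mem_span_singleton'.1 hw'
  have hac : a - z * c ∈ I := by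
    apply hx
    have : x * (a - z * c) = j + z * j' := by linear_combination -h - z * h'
    rw [this]
    exact add_mem hj (Ideal.mul_mem_left _ _ hj')
  rw [← sub_add_cancel a (z * c)]
  exact add_mem (Ideal.mem_sup_left hac)
    (Ideal.mem_sup_right (Ideal.mul_mem_right _ _ (Ideal.mem_span_singleton_self z)))

/-- If some nonzero element of `A ⧸ (I + (f))` is killed by `m`, the same holds for
`A ⧸ (I + (x))`. -/
lemma exists_socle_of_exists_socle {A : Type*} [CommRing A] {m I : Ideal A} {f x : A}
    (hxm : x ∈ m) (hf : ∀ a, f * a ∈ I → a ∈ I) (hx : ∀ a, x * a ∈ I → a ∈ I)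
    {u : A} (hu : u ∉ I ⊔ Ideal.span {f}) (hmu : ∀ z ∈ m, z * u ∈ I ⊔ Ideal.span {f}) :
    ∃ v, v ∉ I ⊔ Ideal.span {x} ∧ ∀ z ∈ m, z * v ∈ I ⊔ Ideal.span {x} := by
  obtain ⟨j, hj, w, hw, h⟩ := Submodule.mem_sup.1 (hmu x hxm)
  obtain ⟨v, rfl⟩ := Ideal.mem_span_singleton'.1 hw
  refine ⟨v, fun hv => hu ?_, fun z hz => ?_⟩
  · obtain ⟨j', hj', w', hw', h'⟩ := Submodule.mem_sup.1 hv
    obtain ⟨c, rfl⟩ := Ideal.mem_span_singleton'.1 hw'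
    have : u - c * f ∈ I := by
      apply hx
      have : x * (u - c * f) = j + f * j' := by linear_combination -h - f * h'
      rw [this]
      exact add_mem hj (Ideal.mul_mem_left _ _ hj')
    rw [← sub_add_cancel u (c * f)]
    exact add_mem (Ideal.mem_sup_left this)
      (Ideal.mem_sup_right (Ideal.mul_mem_left _ _ (Ideal.mem_span_singleton_self f)))
  · obtain ⟨j', hj', w', hw', h'⟩ := Submodule.mem_sup.1 (hmu z hz)
    obtain ⟨c, rfl⟩ := Ideal.mem_span_singleton'.1 hw'
    have : z * v - c * x ∈ I := by
      apply hf
      have : f * (z * v - c * x) = x * j' - z * j := by linear_combination z * h - x * h'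
      rw [this]
      exact sub_mem (Ideal.mul_mem_left _ _ hj') (Ideal.mul_mem_left _ _ hj)
    rw [← sub_add_cancel (z * v) (c * x)]
    exact add_mem (Ideal.mem_sup_left this)
      (Ideal.mem_sup_right (Ideal.mul_mem_left _ _ (Ideal.mem_span_singleton_self x)))

lemma exists_mem_isSMulRegular_of_forall_ne_zero {A M : Type*} [CommRing A] [IsNoetherianRing A]
    [AddCommGroup M] [Module A M] [Module.Finite A M] (m : Ideal A)
    (h : ∀ u : M, (∀ z ∈ m, z • u = 0) → u = 0) : ∃ z ∈ m, IsSMulRegular M z := by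
  by_contra! hc
  have hsub : (m : Set A) ⊆ ⋃ p ∈ associatedPrimes A M, (p : Set A) := by
    rw [biUnion_associatedPrimes_eq_compl_regular A M]
    exact fun z hz => hc z hz
  obtain ⟨p, hp, hmp⟩ := (Ideal.subset_union_prime_finite (associatedPrimes.finite A M) (f := id)
    0 0 (fun P hP _ _ => hP.isPrime)).1 hsub
  obtain ⟨hpp, u, rfl⟩ := isAssociatedPrime_iff.1 (show IsAssociatedPrime p M from hp)
  have hu : u = 0 := h u fun z hz => by
    simpa [Submodule.mem_colon_singleton] using hmp hz
  apply hpp.ne_top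
  simp [hu]

/-- Simultaneous prime avoidance for two cyclic modules. -/
lemma exists_mem_regular_both {A : Type*} [CommRing A] [IsNoetherianRing A] (m I₁ I₂ : Ideal A)
    (h₁ : ∀ u, (∀ z ∈ m, z * u ∈ I₁) → u ∈ I₁) (h₂ : ∀ u, (∀ z ∈ m, z * u ∈ I₂) → u ∈ I₂) :
    ∃ z ∈ m, (∀ a, z * a ∈ I₁ → a ∈ I₁) ∧ (∀ a, z * a ∈ I₂ → a ∈ I₂) := by
  have hmk : ∀ z a b : A, z • (Ideal.Quotient.mk I₁ a, Ideal.Quotient.mk I₂ b) = 0 ↔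
      z * a ∈ I₁ ∧ z * b ∈ I₂ := by
    intro z a b
    rw [← Ideal.Quotient.eq_zero_iff_mem, ← Ideal.Quotient.eq_zero_iff_mem, ← Prod.mk_eq_zero]
    rfl
  have hmk' : ∀ a b : A, (Ideal.Quotient.mk I₁ a, Ideal.Quotient.mk I₂ b) = 0 ↔
      a ∈ I₁ ∧ b ∈ I₂ := by
    intro a b
    simpa using hmk 1 a b
  obtain ⟨z, hzm, hz⟩ := exists_mem_isSMulRegular_of_forall_ne_zero
    (M := (A ⧸ I₁) × (A ⧸ I₂)) m (by
      rintro ⟨u₁, u₂⟩ hu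
      obtain ⟨u₁, rfl⟩ := Ideal.Quotient.mk_surjective u₁
      obtain ⟨u₂, rfl⟩ := Ideal.Quotient.mk_surjective u₂
      exact (hmk' _ _).2 ⟨h₁ _ fun z hz => ((hmk _ _ _).1 (hu z hz)).1,
        h₂ _ fun z hz => ((hmk _ _ _).1 (hu z hz)).2⟩)
  rw [isSMulRegular_iff_right_eq_zero_of_smul] at hz
  exact ⟨z, hzm,
    fun a ha => ((hmk' a 0).1 (hz _ ((hmk z a 0).2 ⟨ha, by simp⟩))).1,
    fun a ha => ((hmk' 0 a).1 (hz _ ((hmk z 0 a).2 ⟨by simp, ha⟩))).2⟩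

/-- Dividing by any regular element of `m` lowers the length of regular sequences by at
most one. -/
lemma HasRegularChain.sup_span {A : Type*} [CommRing A] [IsNoetherianRing A] {m : Ideal A} :
    ∀ {k : ℕ} {I : Ideal A} {f : A}, f ∈ m → (∀ a, f * a ∈ I → a ∈ I) →
      HasRegularChain m (k + 1) I → HasRegularChain m k (I ⊔ Ideal.span {f}) := by
  intro k
  induction k with
  | zero => intros; trivial
  | succ k ih =>
    intro I f hfm hf hI
    obtain ⟨x, hxm, hx, hIx⟩ := hI
    obtain ⟨y, hym, hy, -⟩ := id hIx
    obtain ⟨z, hzm, hzx, hzf⟩ := exists_mem_regular_both m (I ⊔ Ideal.span {x})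
      (I ⊔ Ideal.span {f}) (fun u hu => hy u (hu y hym))
      (fun u hu => by
        by_contra hc
        obtain ⟨v, hv, hmv⟩ := exists_socle_of_exists_socle hxm hf hx hc hu
        exact hv (hy v (hmv y hym)))
    have hz : HasRegularChain m (k + 1) (I ⊔ Ideal.span {z}) := by
      refine ⟨x, hxm, mem_of_mul_mem_sup_span_swap hx hzx, ?_⟩
      rw [sup_right_comm]
      exact ih hzm hzx hIx
    refine ⟨z, hzm, hzf, ?_⟩
    rw [sup_right_comm]
    exact ih hfm (mem_of_mul_mem_sup_span_swap hf hzf) hz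

lemma hasRegularChain_sup_span_iff {A : Type*} [CommRing A] [IsNoetherianRing A] {m I : Ideal A}
    {k : ℕ} {f : A} (hfm : f ∈ m) (hf : ∀ a, f * a ∈ I → a ∈ I) :
    HasRegularChain m k (I ⊔ Ideal.span {f}) ↔ HasRegularChain m (k + 1) I :=
  ⟨fun h => ⟨f, hfm, hf, h⟩, fun h => h.sup_span hfm hf⟩

lemma hasRegularChain_comap_iff {A B : Type*} [CommRing A] [CommRing B] (φ : A →+* B)
    (hφ : Function.Surjective φ) (m : Ideal B) :
    ∀ (k : ℕ) (I : Ideal B),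
      HasRegularChain (m.comap φ) k (I.comap φ) ↔ HasRegularChain m k I := by
  intro k
  induction k with
  | zero => intro I; exact Iff.rfl
  | succ k ih =>
    intro I
    have hsup : ∀ x : A, I.comap φ ⊔ Ideal.span {x} = (I ⊔ Ideal.span {φ x}).comap φ := by
      intro x
      have h : I ⊔ Ideal.span {φ x} = (I.comap φ ⊔ Ideal.span {x}).map φ := by
        rw [Ideal.map_sup, Ideal.map_comap_of_surjective φ hφ, Ideal.map_span,
          Set.image_singleton]
      rw [h, Ideal.comap_map_of_surjective φ hφ, eq_comm, sup_eq_left]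
      exact (Ideal.comap_mono bot_le).trans le_sup_left
    constructor
    · rintro ⟨x, hxm, hx, h⟩
      refine ⟨φ x, hxm, fun b hb => ?_, (ih _).1 (hsup x ▸ h)⟩
      obtain ⟨a, rfl⟩ := hφ b
      exact hx a (by simpa using hb)
    · rintro ⟨y, hym, hy, h⟩
      obtain ⟨x, rfl⟩ := hφ y
      refine ⟨x, hym, fun a ha => hy _ (by simpa using ha), ?_⟩
      rw [hsup]
      exact (ih _).2 h

/-- The ideal of the polynomials in `J₁ A[y]` with constant coefficient in `J₀`. When `J₀ ≤ J₁`,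
it is the ideal `J₀ + y J₁ A[y]` of `A[y]`. -/
def reesLikeIdeal {A : Type*} [CommRing A] (J₀ J₁ : Ideal A) :
    Ideal (Polynomial A) where
  carrier := {g | g.coeff 0 ∈ J₀ ∧ ∀ b, g.coeff b ∈ J₁}
  add_mem' hf hg := by
    simp only [Set.mem_ofPred_eq, Polynomial.coeff_add] at *
    exact ⟨add_mem hf.1 hg.1, fun b => add_mem (hf.2 b) (hg.2 b)⟩
  zero_mem' := by simp
  smul_mem' c g hg := by
    simp only [Set.mem_ofPred_eq, smul_eq_mul] at *
    refine ⟨?_, fun b => ?_⟩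
    · rw [Polynomial.mul_coeff_zero]
      exact Ideal.mul_mem_left _ _ hg.1
    · rw [Polynomial.coeff_mul]
      exact sum_mem fun p _ => Ideal.mul_mem_left _ _ (hg.2 _)

lemma mem_reesLikeIdeal {A : Type*} [CommRing A] {J₀ J₁ : Ideal A} {g : Polynomial A} :
    g ∈ reesLikeIdeal J₀ J₁ ↔ g.coeff 0 ∈ J₀ ∧ ∀ b, g.coeff b ∈ J₁ := Iff.rfl

lemma mem_reesLikeIdeal_of_X_sub_C_mul_mem {A : Type*} [CommRing A] {J₀ J₁ : Ideal A}
    {w : A} (hw : ∀ a ∈ J₁, w * a ∈ J₀ → a ∈ J₀) (g : Polynomial A)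
    (hg : (Polynomial.X - Polynomial.C w) * g ∈ reesLikeIdeal J₀ J₁) :
    g ∈ reesLikeIdeal J₀ J₁ := by
  rw [mem_reesLikeIdeal] at hg ⊢
  obtain ⟨h0, h1⟩ := hg
  have hJ₁ : ∀ d b, g.natDegree < b + d → g.coeff b ∈ J₁ := by
    intro d
    induction d with
    | zero =>
      intro b hb
      rw [Polynomial.coeff_eq_zero_of_natDegree_lt (by simpa using hb)]
      exact zero_mem _
    | succ d ih =>
      intro b hb
      have hc := h1 (b + 1)
      rw [sub_mul, Polynomial.coeff_sub, Polynomial.coeff_X_mul, Polynomial.coeff_C_mul] at hc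
      have := add_mem hc (Ideal.mul_mem_left _ w (ih (b + 1) (by omega)))
      simpa using this
  have hall : ∀ b, g.coeff b ∈ J₁ := fun b => hJ₁ (g.natDegree + 1) b (by omega)
  refine ⟨hw _ (hall 0) ?_, hall⟩
  rw [sub_mul, Polynomial.coeff_sub, Polynomial.coeff_X_mul_zero, Polynomial.coeff_C_mul,
    zero_sub] at h0
  exact neg_mem_iff.1 h0

open Polynomial in
lemma comap_evalRingHom_eq {A : Type*} [CommRing A] {J₀ J₁ : Ideal A} (h : J₀ ≤ J₁) (w : A) :
    (J₀ ⊔ Ideal.span {w} * J₁).comap (evalRingHom w) =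
      reesLikeIdeal J₀ J₁ ⊔ Ideal.span {Polynomial.X - Polynomial.C w} := by
  apply le_antisymm
  · intro g hg
    obtain ⟨j, hj, t, ht, hsum⟩ := Submodule.mem_sup.1 (Ideal.mem_comap.1 hg)
    obtain ⟨j', hj', rfl⟩ := Ideal.mem_span_singleton_mul.1 ht
    rw [coe_evalRingHom] at hsum
    have hr : Polynomial.C j + Polynomial.X * Polynomial.C j' ∈ reesLikeIdeal J₀ J₁ := by
      rw [mem_reesLikeIdeal]
      refine ⟨by simpa using hj, fun b => ?_⟩
      rcases b with _ | _ | b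
      · simpa using h hj
      · simpa [Polynomial.coeff_C] using hj'
      · simp
    rw [← add_sub_cancel (Polynomial.C j + Polynomial.X * Polynomial.C j') g]
    refine add_mem (Ideal.mem_sup_left hr) (Ideal.mem_sup_right ?_)
    rw [Ideal.mem_span_singleton, Polynomial.dvd_iff_isRoot]
    simp [← hsum, mul_comm w]
  · refine sup_le (fun g hg => ?_) ?_
    · obtain ⟨h0, h1⟩ := mem_reesLikeIdeal.1 hg
      rw [Ideal.mem_comap, coe_evalRingHom, ← Polynomial.divX_mul_X_add g]
      simp only [Polynomial.eval_add, Polynomial.eval_mul, Polynomial.eval_X, Polynomial.eval_C]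
      refine add_mem (Ideal.mem_sup_right ?_) (Ideal.mem_sup_left h0)
      refine Ideal.mul_mem_mul_rev (Ideal.mem_span_singleton_self w) ?_
      rw [Polynomial.eval_eq_sum]
      refine sum_mem fun b _ => Ideal.mul_mem_right _ _ ?_
      rw [Polynomial.coeff_divX]
      exact h1 _
    · rw [Ideal.span_singleton_le_iff_mem, Ideal.mem_comap]
      simp

open Polynomial in
lemma comap_evalRingHom_eq_of_mem {A : Type*} [CommRing A] {m : Ideal A} {w : A} (hw : w ∈ m) :
    m.comap (evalRingHom w) = m.comap (evalRingHom 0) := by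
  ext g
  simp only [Ideal.mem_comap, coe_evalRingHom]
  have hd : g.eval w - g.eval 0 ∈ m :=
    m.mem_of_dvd (by simpa using Polynomial.sub_dvd_eval_sub w 0 g) hw
  exact ⟨fun h => by simpa using sub_mem h hd, fun h => by simpa using add_mem hd h⟩

lemma hasRegularChain_sup_span_mul_iff {A : Type*} [CommRing A] [IsNoetherianRing A]
    {m J₀ J₁ : Ideal A} (h : J₀ ≤ J₁) {w : A} (hwm : w ∈ m)
    (hw : ∀ a ∈ J₁, w * a ∈ J₀ → a ∈ J₀) (k : ℕ) :
    HasRegularChain m k (J₀ ⊔ Ideal.span {w} * J₁) ↔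
      HasRegularChain (m.comap (Polynomial.evalRingHom 0)) (k + 1) (reesLikeIdeal J₀ J₁) := by
  rw [← hasRegularChain_comap_iff (Polynomial.evalRingHom w)
    (fun a => ⟨Polynomial.C a, by simp⟩) m, comap_evalRingHom_eq h,
    comap_evalRingHom_eq_of_mem hwm]
  refine hasRegularChain_sup_span_iff ?_ (mem_reesLikeIdeal_of_X_sub_C_mul_mem hw)
  rw [Ideal.mem_comap]
  simpa using hwm

open RingTheory.Sequence Pointwise in
lemma exists_isWeaklyRegular_iff_hasRegularChain {A : Type*} [CommRing A] (m : Ideal A) :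
    ∀ (k : ℕ) (I : Ideal A),
      (∃ rs : List A, (∀ f ∈ rs, f ∈ m) ∧ IsWeaklyRegular (A ⧸ I) rs ∧ rs.length = k) ↔
        HasRegularChain m k I := by
  intro k
  induction k with
  | zero =>
    intro I
    exact ⟨fun _ => trivial, fun _ => ⟨[], by simp, IsWeaklyRegular.nil A _, rfl⟩⟩
  | succ k ih =>
    intro I
    have hreg : ∀ x : A, IsSMulRegular (A ⧸ I) x ↔ ∀ a, x * a ∈ I → a ∈ I := fun x =>
      isSMulRegular_quotient_iff_mem_of_smul_mem I x
    have hquot : ∀ (x : A) (rs : List A), IsWeaklyRegular (QuotSMulTop x (A ⧸ I)) rs ↔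
        IsWeaklyRegular (A ⧸ (I ⊔ Ideal.span {x})) rs := by
      intro x rs
      have he : x • (⊤ : Submodule A (A ⧸ I)) =
          Submodule.map (Submodule.mkQ I) (Ideal.span {x}) := by
        rw [← Submodule.ideal_span_singleton_smul, ← Submodule.range_mkQ I,
          ← Submodule.map_top, ← Submodule.map_smul'', smul_eq_mul, Ideal.mul_top]
      exact LinearEquiv.isWeaklyRegular_congr ((Submodule.quotEquivOfEq _ _ he).trans
        (Submodule.quotientQuotientEquivQuotientSup I (Ideal.span {x}))) rs
    constructor
    · rintro ⟨rs, hm, hrs, hlen⟩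
      obtain _ | ⟨x, rs⟩ := rs
      · simp at hlen
      · rw [isWeaklyRegular_cons_iff] at hrs
        refine ⟨x, hm x (by simp), (hreg x).1 hrs.1, (ih _).1 ⟨rs, fun f hf => hm f (by simp [hf]),
          (hquot x rs).1 hrs.2, by simpa using hlen⟩⟩
    · rintro ⟨x, hxm, hx, h⟩
      obtain ⟨rs, hm, hrs, hlen⟩ := (ih _).2 h
      refine ⟨x :: rs, by simpa using ⟨hxm, hm⟩, ?_, by simp [hlen]⟩
      rw [isWeaklyRegular_cons_iff]
      exact ⟨(hreg x).2 hx, (hquot x rs).2 hrs⟩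

open RingTheory.Sequence in
lemma gradedDepth_eq_sSup_hasRegularChain {n : ℕ} {K : Type*} [Field K]
    {I : Ideal (MvPolynomial (Fin n) K)}
    (hI : I ≤ Ideal.span (Set.range (X : Fin n → MvPolynomial (Fin n) K))) :
    gradedDepth I = sSup {k : ℕ∞ | ∃ d : ℕ, k = d ∧
      HasRegularChain (Ideal.span (Set.range (X : Fin n → MvPolynomial (Fin n) K))) d I} := by
  have hne : Ideal.span (Set.range (X : Fin n → MvPolynomial (Fin n) K)) ≠ ⊤ := by
    have h1 : (1 : MvPolynomial (Fin n) K) ∉ Ideal.span (Set.range X) := by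
      rw [← Set.image_univ, MvPolynomial.mem_ideal_span_X_image]
      intro h
      obtain ⟨i, -, hi⟩ := h 0 (by simp)
      simp at hi
    exact fun h => h1 (h ▸ Submodule.mem_top)
  unfold gradedDepth
  congr 1
  ext k
  constructor
  · rintro ⟨rs, hm, hrs, rfl⟩
    exact ⟨rs.length, rfl, (exists_isWeaklyRegular_iff_hasRegularChain _ _ _).1
      ⟨rs, hm, hrs.toIsWeaklyRegular, rfl⟩⟩
  · rintro ⟨d, rfl, h⟩
    obtain ⟨rs, hm, hrs, rfl⟩ := (exists_isWeaklyRegular_iff_hasRegularChain _ _ _).2 h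
    refine ⟨rs, hm, ⟨hrs, fun htop => hne ?_⟩, rfl⟩
    have hle : Ideal.ofList rs ≤ Ideal.span (Set.range X) := Ideal.span_le.2 hm
    have h1 : Submodule.mkQ I 1 ∈ Ideal.ofList rs •
        (⊤ : Submodule (MvPolynomial (Fin n) K) (MvPolynomial (Fin n) K ⧸ I)) := by
      rw [← htop]
      trivial
    rw [← Submodule.range_mkQ I, ← Submodule.map_top, ← Submodule.map_smul'', smul_eq_mul,
      Ideal.mul_top] at h1
    obtain ⟨y, hy, hy1⟩ := h1
    rw [Submodule.mkQ_apply, Submodule.mkQ_apply, Submodule.Quotient.eq] at hy1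
    rw [Ideal.eq_top_iff_one, ← sub_sub_cancel y 1]
    exact sub_mem (hle hy) (hI hy1)

lemma span_monomial_le_span_range_X {n : ℕ} {K : Type*} [Field K] {S : Set (Fin n →₀ ℕ)}
    (hS : (0 : Fin n →₀ ℕ) ∉ S) :
    Ideal.span ((fun a => monomial a (1 : K)) '' S) ≤ Ideal.span (Set.range X) := by
  rw [Ideal.span_le, ← Set.image_univ]
  rintro _ ⟨a, ha, rfl⟩
  rw [SetLike.mem_coe, MvPolynomial.mem_ideal_span_X_image]
  intro b hb
  have hb' : b = a := by simpa using MvPolynomial.support_monomial_subset hb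
  subst hb'
  obtain ⟨j, hj⟩ := Finsupp.ne_iff.1 (fun h : b = 0 => hS (h ▸ ha))
  exact ⟨j, trivial, by simpa using hj⟩

/-- Let `I` be a monomial ideal, `x_i` a variable, `q` the maximal degree
in `x_i` of the minimal generators of `I`, `p` the maximal degree in `x_i` of the minimal
generators of degree `< q` in `x_i`, and let `L` be the ideal obtained by dividing each
generator of top `x_i`-degree by `x_i`. If `p ≥ 1` and `q - p ≥ 2` then
`depth(R/I) = depth(R/L)`. -/
theorem depth_eq_of_drop_top_power
    {n : ℕ} {K : Type*} [Field K] (I : Ideal (MvPolynomial (Fin n) K))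
    (hI : IsMonomialIdeal I)
    {s : ℕ} (v : Fin s → (Fin n →₀ ℕ)) (hgen : IsMinimalMonomialGens I v)
    (i : Fin n) (hocc : ∃ a, 1 ≤ v a i)
    (q p : ℕ)
    (hq_ub : ∀ a, v a i ≤ q) (hq_att : ∃ a, v a i = q)
    (hp_ub : ∀ a, v a i < q → v a i ≤ p) (hp_att : ∃ a, v a i < q ∧ v a i = p)
    (hp1 : 1 ≤ p) (hqp : p + 2 ≤ q)
    (L : Ideal (MvPolynomial (Fin n) K))
    (hL : L = Ideal.span {f | ∃ a : Fin s,
      f = monomial (if v a i = q then v a - Finsupp.single i 1 else v a) (1 : K)}) :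
    gradedDepth I = gradedDepth L := by
  set m : Ideal (MvPolynomial (Fin n) K) := Ideal.span (Set.range X)
  set A : Set (Fin n →₀ ℕ) := {c | ∃ a, v a i < q ∧ c = v a}
  set B : Set (Fin n →₀ ℕ) := {c | ∃ a, v a i = q ∧ c = v a - Finsupp.single i 2}
  set J₀ : Ideal (MvPolynomial (Fin n) K) :=
    Ideal.span ((fun a => monomial a (1 : K)) '' A) with hJ₀
  set J₁ : Ideal (MvPolynomial (Fin n) K) :=
    Ideal.span ((fun a => monomial a (1 : K)) '' (A ∪ B)) with hJ₁
  have hle : J₀ ≤ J₁ := Ideal.span_mono (Set.image_mono Set.subset_union_left)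
  have hxm : (X i : MvPolynomial (Fin n) K) ∈ m := Ideal.subset_span ⟨i, rfl⟩
  have hreg : ∀ h ∈ J₁, X i * h ∈ J₀ → h ∈ J₀ := by
    intro h h1 h0
    rw [hJ₁, mem_ideal_span_monomial_image] at h1
    rw [hJ₀, mem_ideal_span_monomial_image] at h0 ⊢
    intro w hw
    obtain ⟨c, hc | ⟨b, hb, rfl⟩, hcw⟩ := h1 w hw
    · exact ⟨c, hc, hcw⟩
    · have hwp : p ≤ w i := by
        have := hcw i
        simp only [Finsupp.coe_tsub, Pi.sub_apply, Finsupp.single_eq_same] at this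
        omega
      obtain ⟨_, ⟨a, ha, rfl⟩, hle'⟩ := h0 (Finsupp.single i 1 + w) (by
        rw [mem_support_iff, MvPolynomial.coeff_X_mul]
        exact mem_support_iff.1 hw)
      refine ⟨v a, ⟨a, ha, rfl⟩, fun j => ?_⟩
      by_cases hj : j = i
      · subst hj
        exact (hp_ub a ha).trans hwp
      · simpa [Finsupp.single_apply, Ne.symm hj] using hle' j
  have hreg2 : ∀ h ∈ J₁, X i ^ 2 * h ∈ J₀ → h ∈ J₀ := fun h h1 h0 =>
    hreg h h1 (hreg _ (Ideal.mul_mem_left _ _ h1) (by rwa [pow_two, mul_assoc] at h0))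
  have hmul : ∀ e ≤ 2, ∀ b, v b i = q →
      (X i : MvPolynomial (Fin n) K) ^ e * monomial (v b - Finsupp.single i 2) 1 =
        monomial (v b - Finsupp.single i (2 - e)) 1 := by
    intro e he b hb
    rw [X_pow_eq_monomial, monomial_mul, one_mul]
    refine congrArg (fun c => monomial c (1 : K)) (Finsupp.ext fun j => ?_)
    by_cases hj : j = i
    · subst hj
      simp only [Finsupp.coe_add, Finsupp.coe_tsub, Pi.add_apply, Pi.sub_apply,
        Finsupp.single_eq_same]
      omega
    · simp [Ne.symm hj]
  have hideal : ∀ e ≤ 2, J₀ ⊔ Ideal.span {(X i : MvPolynomial (Fin n) K) ^ e} * J₁ =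
      Ideal.span {f | ∃ a : Fin s, f = monomial
        (if v a i = q then v a - Finsupp.single i (2 - e) else v a) (1 : K)} := by
    intro e he
    apply le_antisymm
    · have h0 : J₀ ≤ Ideal.span {f | ∃ a : Fin s, f = monomial
          (if v a i = q then v a - Finsupp.single i (2 - e) else v a) (1 : K)} := by
        rw [hJ₀, Ideal.span_le]
        rintro _ ⟨_, ⟨a, ha, rfl⟩, rfl⟩
        exact Ideal.subset_span ⟨a, by rw [if_neg ha.ne]⟩
      refine sup_le h0 ?_
      rw [hJ₁, Set.image_union, Ideal.span_union, Ideal.mul_sup]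
      refine sup_le (Ideal.mul_le_right.trans h0) ?_
      rw [Ideal.span_mul_span', Ideal.span_le]
      rintro _ ⟨_, rfl, _, ⟨_, ⟨b, hb, rfl⟩, rfl⟩, rfl⟩
      exact Ideal.subset_span ⟨b, by simp only [if_pos hb]; exact hmul e he b hb⟩
    · rw [Ideal.span_le]
      rintro _ ⟨a, rfl⟩
      by_cases ha : v a i = q
      · rw [if_pos ha, ← hmul e he a ha]
        exact Ideal.mem_sup_right (Ideal.mul_mem_mul (Ideal.mem_span_singleton_self _)
          (Ideal.subset_span ⟨_, Or.inr ⟨a, ha, rfl⟩, rfl⟩))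
      · rw [if_neg ha]
        exact Ideal.mem_sup_left (Ideal.subset_span
          ⟨v a, ⟨a, lt_of_le_of_ne (hq_ub a) ha, rfl⟩, rfl⟩)
  have hIJ : I = J₀ ⊔ Ideal.span {(X i : MvPolynomial (Fin n) K) ^ 2} * J₁ := by
    rw [hideal 2 le_rfl, hgen.1]
    congr 1
    ext f
    simp [eq_comm]
  have hLJ : L = J₀ ⊔ Ideal.span {(X i : MvPolynomial (Fin n) K)} * J₁ := by
    have := hideal 1 one_le_two
    rw [pow_one] at this
    rw [this, hL]
  by_cases hzero : (0 : Fin n →₀ ℕ) ∈ A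
  · have htop : J₀ = ⊤ := by
      rw [Ideal.eq_top_iff_one]
      exact Ideal.subset_span ⟨0, hzero, rfl⟩
    rw [hIJ, hLJ, htop, top_sup_eq, top_sup_eq]
  · have hJm : J₀ ≤ m := span_monomial_le_span_range_X hzero
    have hsupm : ∀ w ∈ m, J₀ ⊔ Ideal.span {w} * J₁ ≤ m := fun w hw =>
      sup_le hJm (Ideal.mul_le_left.trans ((Ideal.span_singleton_le_iff_mem m).2 hw))
    have hxm2 : (X i : MvPolynomial (Fin n) K) ^ 2 ∈ m := Ideal.pow_mem_of_mem m hxm 2 two_pos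
    rw [hIJ, hLJ, gradedDepth_eq_sSup_hasRegularChain (hsupm _ hxm2),
      gradedDepth_eq_sSup_hasRegularChain (hsupm _ hxm)]
    refine congrArg sSup (Set.ext fun k => exists_congr fun d => and_congr_right fun _ => ?_)
    exact (hasRegularChain_sup_span_mul_iff hle hxm2 hreg2 d).trans
      (hasRegularChain_sup_span_mul_iff hle hxm hreg d).symm
end
end

section
/- Let I(D) be the edge ideal of a vertex-weighted oriented graph D with vertices x_1,…,x_n and weights d_1,…,d_n, and let U be the vertex-weighted oriented graph obtained from D by assigning weight 2 to every vertex x_i with d_i ≥ 2. Then I(D) is Cohen–Macaulay if and only if I(U) is Cohen–Macaulay. -/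
open MvPolynomial

noncomputable section

open RingTheory.Sequence in
/-- A (graded) ideal `I` of `R = K[x_1, …, x_n]` is Cohen–Macaulay if `R/I` is a
Cohen–Macaulay ring, i.e. there is a regular sequence on `R/I`, contained in the irrelevant
maximal ideal `(x_1, …, x_n)`, whose length equals the Krull dimension of `R/I`. -/
def IsCohenMacaulayIdeal {n : ℕ} {K : Type*} [Field K]
    (I : Ideal (MvPolynomial (Fin n) K)) : Prop :=
  ∃ rs : List (MvPolynomial (Fin n) K),
    (∀ f ∈ rs, f ∈ Ideal.span (Set.range (X : Fin n → MvPolynomial (Fin n) K))) ∧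
    IsRegular (MvPolynomial (Fin n) K ⧸ I) rs ∧
    (rs.length : WithBot ℕ∞) = ringKrullDim (MvPolynomial (Fin n) K ⧸ I)

universe u

section ExtVanishing

open CategoryTheory Abelian RingTheory.Sequence

lemma ModuleCat.ext_smul_eq_zero_of_mem_annihilator {R : Type u} [CommRing R]
    {N M : ModuleCat.{u} R} {t : R} (ht : t ∈ Module.annihilator R N) {i : ℕ} (x : Ext N M i) :
    t • x = 0 := by
  have h0 : t • 𝟙 N = 0 := by
    ext y
    exact Module.mem_annihilator.mp ht y
  have h1 : t • x = (Ext.mk₀ (t • 𝟙 N)).comp x (zero_add i) := by simp [Ext.mk₀_smul]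
  rw [h1, h0]
  simp

/-- If a short exact sequence `0 → N → M → L → 0` starts with `t` times a linear map and `t`
kills `X`, then its long exact `Ext(X, -)` sequence splits into short exact sequences. -/
lemma ModuleCat.subsingleton_ext_iff_of_exact_smul {R : Type u} [CommRing R]
    {X N M L : ModuleCat.{u} R} {t : R} (ht : t ∈ Module.annihilator R X)
    (f : N →ₗ[R] M) (g : M →ₗ[R] L) (hinj : Function.Injective (t • f))
    (hexact : Function.Exact (t • f) g) (hsurj : Function.Surjective g) (i : ℕ) :
    Subsingleton (Ext X L i) ↔ Subsingleton (Ext X M i) ∧ Subsingleton (Ext X N (i + 1)) := by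
  let S : ShortComplex (ModuleCat.{u} R) :=
    ModuleCat.shortComplexOfCompEqZero (t • f) g hexact.linearMap_comp_eq_zero
  have hS : S.ShortExact :=
    { exact := ModuleCat.shortComplex_exact _ hexact
      mono_f := (ModuleCat.mono_iff_injective _).mpr hinj
      epi_g := (ModuleCat.epi_iff_surjective _).mpr hsurj }
  have hf : S.f = t • ModuleCat.ofHom f := rfl
  have hzero : ∀ (k : ℕ) (x : Ext X S.X₁ k), x.comp (Ext.mk₀ S.f) (add_zero k) = 0 := by
    intro k x
    rw [hf, Ext.mk₀_smul, Ext.comp_smul]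
    exact ModuleCat.ext_smul_eq_zero_of_mem_annihilator ht _
  constructor
  · intro hL
    refine ⟨subsingleton_of_forall_eq 0 fun x ↦ ?_, subsingleton_of_forall_eq 0 fun x ↦ ?_⟩
    · have hx : x.comp (Ext.mk₀ S.g) (add_zero i) = 0 := @Subsingleton.elim _ hL _ _
      obtain ⟨y, rfl⟩ := Ext.covariant_sequence_exact₂ X hS x hx
      exact hzero i y
    · obtain ⟨y, rfl⟩ := Ext.covariant_sequence_exact₁ X hS x (hzero _ x) rfl
      rw [show y = 0 from @Subsingleton.elim _ hL _ _]
      simp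
  · rintro ⟨hM, hN⟩
    refine subsingleton_of_forall_eq 0 fun x ↦ ?_
    obtain ⟨y, rfl⟩ := Ext.covariant_sequence_exact₃ X hS x rfl (@Subsingleton.elim _ hN _ _)
    rw [show y = 0 from @Subsingleton.elim _ hM _ _]
    simp

/-- For ideals `P ≤ Q` and `t ∈ I` regular on `Q / P`, the vanishing of `Ext^i(R/I, R/(P + tQ))`
is governed by `P` and `Q` alone. -/
lemma Ideal.subsingleton_ext_quotient_sup_mul_iff {R : Type u} [CommRing R] {I P Q : Ideal R}
    {t : R} (htI : t ∈ I) (hreg : ∀ q ∈ Q, t * q ∈ P → q ∈ P) (i : ℕ) :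
    Subsingleton (Ext (ModuleCat.of R (R ⧸ I))
        (ModuleCat.of R (R ⧸ (P ⊔ Ideal.span {t} * Q))) i) ↔
      Subsingleton (Ext (ModuleCat.of R (R ⧸ I)) (ModuleCat.of R (R ⧸ P)) i) ∧
      Subsingleton (Ext (ModuleCat.of R (R ⧸ I))
        (ModuleCat.of R (Submodule.map P.mkQ Q : Submodule R (R ⧸ P))) (i + 1)) := by
  refine ModuleCat.subsingleton_ext_iff_of_exact_smul (t := t) ?_
    (Submodule.map P.mkQ Q).subtype (Submodule.factor le_sup_left) ?_ ?_ ?_ i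
  · rw [Ideal.annihilator_quotient]
    exact htI
  · rw [← LinearMap.ker_eq_bot, LinearMap.ker_eq_bot']
    rintro ⟨_, q, hq, rfl⟩ hx
    ext
    exact (Submodule.Quotient.mk_eq_zero P).mpr
      (hreg q hq ((Submodule.Quotient.mk_eq_zero P).mp hx))
  · intro y
    obtain ⟨a, rfl⟩ := Submodule.mkQ_surjective P y
    have h1 : Submodule.factor (le_sup_left : P ≤ P ⊔ Ideal.span {t} * Q) (P.mkQ a) = 0 ↔
        a ∈ P ⊔ Ideal.span {t} * Q := Submodule.Quotient.mk_eq_zero _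
    rw [h1, Submodule.mem_sup]
    constructor
    · rintro ⟨p, hp, z, hz, rfl⟩
      obtain ⟨q, hq, rfl⟩ := Ideal.mem_span_singleton_mul.mp hz
      refine ⟨⟨P.mkQ q, q, hq, rfl⟩, ?_⟩
      exact (Submodule.Quotient.eq P).mpr (by simpa using hp)
    · rintro ⟨⟨_, q, hq, rfl⟩, hx⟩
      have h2 : t * q - a ∈ P := (Submodule.Quotient.eq P).mp hx
      exact ⟨a - t * q, by simpa using P.neg_mem h2, t * q,
        Ideal.mem_span_singleton_mul.mpr ⟨q, hq, rfl⟩, by ring⟩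
  · exact Submodule.factor_surjective _

lemma Ideal.exists_isRegular_quotient_iff_subsingleton_ext {R : Type u} [CommRing R]
    [IsNoetherianRing R] {I J : Ideal R} (hI : I ≠ ⊤) (hJ : J ≤ I) (r : ℕ) :
    (∃ rs : List R, rs.length = r ∧ (∀ x ∈ rs, x ∈ I) ∧ IsRegular (R ⧸ J) rs) ↔
      ∀ i < r, Subsingleton (Ext (ModuleCat.of R (R ⧸ I)) (ModuleCat.of R (R ⧸ J)) i) := by
  have hlt : I • (⊤ : Submodule R (ModuleCat.of R (R ⧸ J))) < ⊤ := by
    rw [lt_top_iff_ne_top]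
    intro h
    apply hI
    rw [Ideal.eq_top_iff_one]
    have h1 : (Ideal.Quotient.mk J 1 : R ⧸ J) ∈ I • (⊤ : Submodule R (R ⧸ J)) := by
      change _ ∈ I • (⊤ : Submodule R (ModuleCat.of R (R ⧸ J)))
      rw [h]
      trivial
    have h2 : I • (⊤ : Submodule R (R ⧸ J)) ≤ Submodule.map J.mkQ I := by
      rw [Submodule.smul_le]
      intro a ha y _
      obtain ⟨b, rfl⟩ := Submodule.mkQ_surjective J y
      exact ⟨a * b, I.mul_mem_right b ha, rfl⟩
    obtain ⟨a, ha, hab⟩ := h2 h1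
    have h3 : a - 1 ∈ J := (Submodule.Quotient.eq J).mp hab
    simpa using I.sub_mem ha (hJ h3)
  have hsupp : Module.support R (ModuleCat.of R (R ⧸ I)) = PrimeSpectrum.zeroLocus I := by
    rw [Module.support_eq_zeroLocus, Ideal.annihilator_quotient]
  constructor
  · rintro ⟨rs, rfl, hmem, hreg⟩
    exact ModuleCat.subsingleton_ext_of_exists_isRegular I _ hsupp.subset _ hlt rs hmem hreg
  · exact ModuleCat.exists_isRegular_of_exists_subsingleton_ext I r _ hlt _ hsupp

end ExtVanishing

section MonomialIdeal

lemma MvPolynomial.X_mul_mem_span_monomial {σ K : Type*} [CommRing K]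
    {s : Set (σ →₀ ℕ)} {j : σ} (hs : ∀ a ∈ s, a j ≤ 1) {k : ℕ} {g : MvPolynomial σ K}
    (hg : X j ^ (k + 1) * g ∈ Ideal.span ((fun a ↦ monomial a (1 : K)) '' s)) :
    X j * g ∈ Ideal.span ((fun a ↦ monomial a (1 : K)) '' s) := by
  classical
  rw [mem_ideal_span_monomial_image] at hg ⊢
  intro b hb
  have hcomm : X j * g = g * X j := mul_comm _ _
  rw [hcomm, support_mul_X, Finset.mem_map] at hb
  obtain ⟨c, hc, rfl⟩ := hb
  have hc' : Finsupp.single j (k + 1) + c ∈ (X j ^ (k + 1) * g).support := by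
    rw [mem_support_iff, X_pow_eq_monomial, coeff_monomial_mul, one_mul]
    exact mem_support_iff.mp hc
  obtain ⟨a, ha, hle⟩ := hg _ hc'
  refine ⟨a, ha, fun i ↦ ?_⟩
  have hi := hle i
  have haj := hs a ha
  by_cases hij : j = i
  · subst hij
    simp
    omega
  · simpa [Finsupp.single_apply, hij] using hi

end MonomialIdeal

section WeightedOrientedGraph

/-- The ideal generated by `x_i x_j ^ w_j` over the pairs `(i, j)` related by `E`. -/
def weightedIdeal (K : Type*) [Field K] {n : ℕ} (E : Fin n → Fin n → Prop) (w : Fin n → ℕ) :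
    Ideal (MvPolynomial (Fin n) K) :=
  Ideal.span {f | ∃ i j, E i j ∧ f = X i * (X j : MvPolynomial (Fin n) K) ^ w j}

variable {K : Type*} [Field K] {n : ℕ} {E : Fin n → Fin n → Prop}

lemma weightedIdeal_eq_span_monomial (w : Fin n → ℕ) :
    weightedIdeal K E w = Ideal.span ((fun a ↦ monomial a (1 : K)) ''
      {a | ∃ i j, E i j ∧ a = Finsupp.single i 1 + Finsupp.single j (w j)}) := by
  have h (i j : Fin n) : (X i * X j ^ w j : MvPolynomial (Fin n) K) =
      monomial (Finsupp.single i 1 + Finsupp.single j (w j)) 1 := by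
    rw [X_pow_eq_monomial, X, monomial_mul, one_mul]
  unfold weightedIdeal
  congr 1
  ext f
  constructor
  · rintro ⟨i, j, hij, rfl⟩
    exact ⟨_, ⟨i, j, hij, rfl⟩, (h i j).symm⟩
  · rintro ⟨_, ⟨i, j, hij, rfl⟩, rfl⟩
    exact ⟨i, j, hij, (h i j).symm⟩

lemma weightedIdeal_le_span_X (w : Fin n → ℕ) :
    weightedIdeal K E w ≤ Ideal.span (Set.range (X : Fin n → MvPolynomial (Fin n) K)) := by
  rw [weightedIdeal, Ideal.span_le]
  rintro _ ⟨i, j, _, rfl⟩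
  exact Ideal.mul_mem_right _ _ (Ideal.subset_span ⟨i, rfl⟩)

lemma span_range_X_ne_top :
    Ideal.span (Set.range (X : Fin n → MvPolynomial (Fin n) K)) ≠ ⊤ := by
  intro h
  have h1 : Ideal.span (Set.range (X : Fin n → MvPolynomial (Fin n) K)) ≤
      RingHom.ker (constantCoeff : MvPolynomial (Fin n) K →+* K) := by
    rw [Ideal.span_le]
    rintro _ ⟨i, rfl⟩
    simp
  have h2 : (1 : MvPolynomial (Fin n) K) ∈ RingHom.ker constantCoeff :=
    h1 (h ▸ Submodule.mem_top)
  simp at h2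

lemma ringKrullDim_quotient_weightedIdeal {w : Fin n → ℕ} (hw : ∀ i, w i ≠ 0) :
    ringKrullDim (MvPolynomial (Fin n) K ⧸ weightedIdeal K E w) =
      ringKrullDim (MvPolynomial (Fin n) K ⧸ weightedIdeal K E 1) := by
  have h : PrimeSpectrum.zeroLocus (weightedIdeal K E w : Set (MvPolynomial (Fin n) K)) =
      PrimeSpectrum.zeroLocus (weightedIdeal K E 1 : Set (MvPolynomial (Fin n) K)) := by
    ext p
    simp only [weightedIdeal, PrimeSpectrum.zeroLocus_span, PrimeSpectrum.mem_zeroLocus]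
    constructor
    all_goals
      rintro h _ ⟨i, j, hij, rfl⟩
      have h1 := h ⟨i, j, hij, rfl⟩
      have := p.isPrime
      have hw' := hw j
      simp_all [Ideal.IsPrime.mul_mem_iff_mem_or_mem, Ideal.IsPrime.pow_mem_iff_mem,
        Nat.pos_iff_ne_zero]
  rw [ringKrullDim_quotient, ringKrullDim_quotient, h]

/-- The edges not ending at `j`, and all edges with the weight of `j` lowered to one, determine
the weighted ideal by a single multiplication with a power of `x_j`. -/
lemma weightedIdeal_eq_sup (j : Fin n) (w : Fin n → ℕ) (k : ℕ) :
    weightedIdeal K E (Function.update w j (k + 1)) =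
      weightedIdeal K (fun a b ↦ E a b ∧ b ≠ j) w ⊔
        Ideal.span {X j ^ k} * weightedIdeal K E (Function.update w j 1) := by
  apply le_antisymm
  · refine Ideal.span_le.mpr ?_
    rintro _ ⟨a, b, hab, rfl⟩
    by_cases hb : b = j
    · subst hb
      refine Ideal.mem_sup_right (Ideal.mem_span_singleton_mul.mpr
        ⟨X a * X b, Ideal.subset_span ⟨a, b, hab, by simp⟩, ?_⟩)
      rw [Function.update_self]
      ring
    · exact Ideal.mem_sup_left (Ideal.subset_span ⟨a, b, ⟨hab, hb⟩, by simp [hb]⟩)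
  · refine sup_le (Ideal.span_le.mpr ?_) ?_
    · rintro _ ⟨a, b, ⟨hab, hb⟩, rfl⟩
      exact Ideal.subset_span ⟨a, b, hab, by simp [hb]⟩
    · rw [weightedIdeal, weightedIdeal, Ideal.span_mul_span', Ideal.span_le]
      rintro _ ⟨_, rfl, _, ⟨a, b, hab, rfl⟩, rfl⟩
      by_cases hb : b = j
      · subst hb
        refine Ideal.subset_span ⟨a, b, hab, ?_⟩
        simp only [Function.update_self]
        ring
      · refine Ideal.mul_mem_left _ _ (Ideal.subset_span ⟨a, b, hab, by simp [hb]⟩)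

lemma mem_weightedIdeal_of_X_pow_mul_mem (j : Fin n) (w : Fin n → ℕ) (k : ℕ)
    {q : MvPolynomial (Fin n) K} (hq : q ∈ weightedIdeal K E (Function.update w j 1))
    (h : X j ^ k * q ∈ weightedIdeal K (fun a b ↦ E a b ∧ b ≠ j) w) :
    q ∈ weightedIdeal K (fun a b ↦ E a b ∧ b ≠ j) w := by
  set P := weightedIdeal K (fun a b ↦ E a b ∧ b ≠ j) w with hP
  have hle : weightedIdeal K E (Function.update w j 1) ≤ P ⊔ Ideal.span {X j} := by
    refine Ideal.span_le.mpr ?_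
    rintro _ ⟨a, b, hab, rfl⟩
    by_cases hb : b = j
    · subst hb
      exact Ideal.mem_sup_right (Ideal.mem_span_singleton.mpr ⟨X a, by simp [mul_comm]⟩)
    · exact Ideal.mem_sup_left (Ideal.subset_span ⟨a, b, ⟨hab, hb⟩, by simp [hb]⟩)
  obtain ⟨p, hp, z, hz, rfl⟩ := Submodule.mem_sup.mp (hle hq)
  obtain ⟨g, rfl⟩ := Ideal.mem_span_singleton.mp hz
  refine P.add_mem hp ?_
  have hg : X j ^ (k + 1) * g ∈ P := by
    have := P.sub_mem h (P.mul_mem_left (X j ^ k) hp)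
    rwa [show X j ^ k * (p + X j * g) - X j ^ k * p = X j ^ (k + 1) * g by ring] at this
  rw [hP, weightedIdeal_eq_span_monomial] at hg ⊢
  refine X_mul_mem_span_monomial ?_ hg
  rintro _ ⟨a, b, ⟨-, hb⟩, rfl⟩
  simp only [Finsupp.add_apply, Finsupp.single_eq_of_ne' hb, add_zero]
  rw [Finsupp.single_apply]
  split_ifs <;> simp

open CategoryTheory Abelian

/-- Vanishing of the groups `Ext^i(K, R/I)` for `i < r`, where `I` is the weighted ideal of the
relation `E` and the weights `w`. -/
def ExtVanishesBelow (K : Type u) [Field K] {n : ℕ} (E : Fin n → Fin n → Prop) (w : Fin n → ℕ)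
    (r : ℕ) : Prop :=
  ∀ i < r, Subsingleton (Ext
    (ModuleCat.of (MvPolynomial (Fin n) K) (MvPolynomial (Fin n) K ⧸
      Ideal.span (Set.range (X : Fin n → MvPolynomial (Fin n) K))))
    (ModuleCat.of (MvPolynomial (Fin n) K) (MvPolynomial (Fin n) K ⧸ weightedIdeal K E w)) i)

lemma extVanishesBelow_update_iff (j : Fin n) (w : Fin n → ℕ) {k l : ℕ} (hk : k ≠ 0) (hl : l ≠ 0)
    (r : ℕ) :
    ExtVanishesBelow K E (Function.update w j (k + 1)) r ↔
      ExtVanishesBelow K E (Function.update w j (l + 1)) r := by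
  have hmem {m : ℕ} (hm : m ≠ 0) : (X j ^ m : MvPolynomial (Fin n) K) ∈
      Ideal.span (Set.range (X : Fin n → MvPolynomial (Fin n) K)) :=
    Ideal.pow_mem_of_mem _ (Ideal.subset_span (Set.mem_range_self j)) m (Nat.pos_of_ne_zero hm)
  unfold ExtVanishesBelow
  rw [weightedIdeal_eq_sup j w k, weightedIdeal_eq_sup j w l]
  refine forall₂_congr fun i _ ↦ ?_
  rw [Ideal.subsingleton_ext_quotient_sup_mul_iff (hmem hk)
      (fun q ↦ mem_weightedIdeal_of_X_pow_mul_mem j w k),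
    Ideal.subsingleton_ext_quotient_sup_mul_iff (hmem hl)
      (fun q ↦ mem_weightedIdeal_of_X_pow_mul_mem j w l)]

lemma extVanishesBelow_iff_of_two_le {w v : Fin n → ℕ}
    (h : ∀ i, w i = v i ∨ 2 ≤ w i ∧ 2 ≤ v i) (r : ℕ) :
    ExtVanishesBelow K E w r ↔ ExtVanishesBelow K E v r := by
  classical
  have key (s : Finset (Fin n)) :
      ExtVanishesBelow K E w r ↔ ExtVanishesBelow K E (s.piecewise v w) r := by
    induction s using Finset.induction_on with
    | empty => simp
    | insert j s hj ih =>
      rw [ih, Finset.piecewise_insert]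
      have hself : s.piecewise v w = Function.update (s.piecewise v w) j (w j) := by
        rw [← Finset.piecewise_eq_of_notMem s v w hj, Function.update_eq_self]
      rcases h j with hj' | ⟨hw, hv⟩
      · rw [← hj', ← hself]
      · conv_lhs => rw [hself]
        obtain ⟨k, hk⟩ := Nat.exists_eq_add_of_le' hw
        obtain ⟨l, hl⟩ := Nat.exists_eq_add_of_le' hv
        rw [hk, hl]
        exact extVanishesBelow_update_iff j _ k.succ_ne_zero l.succ_ne_zero r
  simpa using key Finset.univ

lemma isCohenMacaulayIdeal_weightedIdeal_iff {w : Fin n → ℕ} (hw : ∀ i, w i ≠ 0) :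
    IsCohenMacaulayIdeal (weightedIdeal K E w) ↔
      ∃ r : ℕ, ExtVanishesBelow K E w r ∧
        (r : WithBot ℕ∞) = ringKrullDim (MvPolynomial (Fin n) K ⧸ weightedIdeal K E 1) := by
  rw [← ringKrullDim_quotient_weightedIdeal hw]
  have key := Ideal.exists_isRegular_quotient_iff_subsingleton_ext
    (span_range_X_ne_top (K := K)) (weightedIdeal_le_span_X (E := E) w)
  constructor
  · rintro ⟨rs, hmem, hreg, hdim⟩
    exact ⟨rs.length, (key _).mp ⟨rs, rfl, hmem, hreg⟩, hdim⟩
  · rintro ⟨r, hr, hdim⟩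
    obtain ⟨rs, rfl, hmem, hreg⟩ := (key r).mpr hr
    exact ⟨rs, hmem, hreg, hdim⟩

end WeightedOrientedGraph

/-- If `U` is obtained from a vertex-weighted oriented graph `D` by
assigning weight `2` to every vertex of weight `≥ 2`, then `I(D)` is Cohen–Macaulay iff
`I(U)` is Cohen–Macaulay. -/
theorem edgeIdeal_cm_iff_weights_two
    {n : ℕ} (K : Type*) [Field K] (D U : WOG n)
    (hE : U.E = D.E)
    (hd : ∀ i, U.d i = if 2 ≤ D.d i then 2 else D.d i) :
    IsCohenMacaulayIdeal (edgeIdeal K D) ↔ IsCohenMacaulayIdeal (edgeIdeal K U) := by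
  have hD : edgeIdeal K D = weightedIdeal K D.E D.d := rfl
  have hU : edgeIdeal K U = weightedIdeal K D.E U.d := hE ▸ rfl
  rw [hD, hU, isCohenMacaulayIdeal_weightedIdeal_iff fun i ↦ (Nat.one_le_iff_ne_zero.mp (D.dpos i)),
    isCohenMacaulayIdeal_weightedIdeal_iff fun i ↦ (Nat.one_le_iff_ne_zero.mp (U.dpos i))]
  refine exists_congr fun r ↦ and_congr_left fun _ ↦ extVanishesBelow_iff_of_two_le (fun i ↦ ?_) r
  rw [hd i]
  split_ifs with h
  · exact Or.inr ⟨h, le_rfl⟩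
  · exact Or.inl rfl
end
end

section
/- Let I ⊂ R be a squarefree monomial ideal and let d_i = d(x_i) be a positive integer weight for each variable. If G' is the set of monomials obtained from G(I) by replacing each occurrence of x_i with x_i^{d_i}, then I is Cohen–Macaulay if and only if the ideal I' = (G') is Cohen–Macaulay. -/
open MvPolynomial

noncomputable section

open RingTheory.Sequence Pointwise

section Depth

variable {R : Type*} [CommRing R]

theorem IsSMulRegular.quotSMulTop_swap {M : Type*} [AddCommGroup M] [Module R M] {a b : R}
    (ha : IsSMulRegular M a) (hab : IsSMulRegular (QuotSMulTop a M) b) :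
    IsSMulRegular (QuotSMulTop b M) a := by
  rw [isSMulRegular_quotient_iff_mem_of_smul_mem] at hab ⊢
  intro x hx
  obtain ⟨y, -, hy⟩ := (Submodule.mem_smul_pointwise_iff_exists _ _ _).1 hx
  obtain ⟨z, -, hz⟩ := (Submodule.mem_smul_pointwise_iff_exists _ _ _).1
    (hab y (hy ▸ Submodule.smul_mem_pointwise_smul x a ⊤ trivial))
  refine (Submodule.mem_smul_pointwise_iff_exists _ _ _).2 ⟨z, trivial, ha ?_⟩
  change a • b • z = a • x
  rw [← hy, ← hz, smul_comm]

theorem RingTheory.Sequence.IsWeaklyRegular.swap_head {M : Type*} [AddCommGroup M] [Module R M]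
    {a b : R} {rs : List R} (h : IsWeaklyRegular M (a :: b :: rs)) (hb : IsSMulRegular M b) :
    IsWeaklyRegular M (b :: a :: rs) := by
  have h1 := (isWeaklyRegular_append_iff M [a, b] rs).1 h
  refine (isWeaklyRegular_append_iff M [b, a] rs).2 ⟨?_, ?_⟩
  · have h2 := h1.1
    simp only [isWeaklyRegular_cons_iff, IsWeaklyRegular.nil, and_true] at h2 ⊢
    exact ⟨hb, h2.1.quotSMulTop_swap h2.2⟩
  · have : Ideal.ofList [b, a] = Ideal.ofList [a, b] := by simp [sup_comm]
    rw [this]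
    exact h1.2

theorem Ideal.exists_isSMulRegular_of_forall_smul_eq_zero [IsNoetherianRing R] {M : Type*}
    [AddCommGroup M] [Module R M] [Module.Finite R M] (J : Ideal R)
    (h : ∀ m : M, (∀ a ∈ J, a • m = 0) → m = 0) : ∃ a ∈ J, IsSMulRegular M a := by
  have : Subsingleton ((R ⧸ J) →ₗ[R] M) := by
    refine subsingleton_of_forall_eq 0 fun f => ?_
    ext
    refine h _ fun a ha => ?_
    rw [LinearMap.comp_apply, ← map_smul, Submodule.mkQ_apply, ← Submodule.Quotient.mk_smul,
      (Submodule.Quotient.mk_eq_zero J).2 (by simpa using ha), map_zero]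
  obtain ⟨a, ha, hr⟩ := IsSMulRegular.subsingleton_linearMap_iff.1 this
  exact ⟨a, by rwa [Ideal.annihilator_quotient] at ha, hr⟩

theorem IsSMulRegular.of_prod {M N : Type*} [AddCommGroup M] [Module R M] [AddCommGroup N]
    [Module R N] {a : R} (h : IsSMulRegular (M × N) a) :
    IsSMulRegular M a ∧ IsSMulRegular N a :=
  ⟨fun x y hxy => congrArg Prod.fst (@h (x, 0) (y, 0) (Prod.ext hxy rfl)),
    fun x y hxy => congrArg Prod.snd (@h (0, x) (0, y) (Prod.ext rfl hxy))⟩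

/-- Both conditions say that `Ext¹(R ⧸ J, M)` vanishes. -/
theorem QuotSMulTop.eq_zero_of_forall_smul_eq_zero_of_isSMulRegular {M : Type*} [AddCommGroup M]
    [Module R M] {J : Ideal R} {a b : R} (hbJ : b ∈ J) (ha : IsSMulRegular M a)
    (hb : IsSMulRegular M b)
    (h : ∀ m : QuotSMulTop b M, (∀ c ∈ J, c • m = 0) → m = 0)
    (m : QuotSMulTop a M) (hm : ∀ c ∈ J, c • m = 0) : m = 0 := by
  obtain ⟨m, rfl⟩ := Submodule.Quotient.mk_surjective _ m
  have key : ∀ c ∈ J, ∃ y : M, a • y = c • m := fun c hc => by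
    have := hm c hc
    rw [← Submodule.Quotient.mk_smul, Submodule.Quotient.mk_eq_zero,
      Submodule.mem_smul_pointwise_iff_exists] at this
    obtain ⟨y, -, hy⟩ := this
    exact ⟨y, hy⟩
  obtain ⟨n, hn⟩ := key b hbJ
  have hn0 := h (Submodule.Quotient.mk n) fun c hc => by
    obtain ⟨y, hy⟩ := key c hc
    rw [← Submodule.Quotient.mk_smul, Submodule.Quotient.mk_eq_zero,
      Submodule.mem_smul_pointwise_iff_exists]
    refine ⟨y, trivial, ha ?_⟩
    change a • b • y = a • c • n
    rw [smul_comm a b, hy, smul_comm a c, hn, smul_comm]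
  rw [Submodule.Quotient.mk_eq_zero, Submodule.mem_smul_pointwise_iff_exists] at hn0 ⊢
  obtain ⟨z, -, hz⟩ := hn0
  refine ⟨z, trivial, hb ?_⟩
  change b • a • z = b • m
  rw [← hn, ← hz, smul_comm]

/-- Any `M`-regular element of `J` can be the first term of a weakly regular sequence in `J`
which is as long as a given one. -/
theorem RingTheory.Sequence.IsWeaklyRegular.exists_cons_of_isSMulRegular [IsNoetherianRing R]
    {J : Ideal R} {k : ℕ} :
    ∀ {M : Type*} [AddCommGroup M] [Module R M] [Module.Finite R M] {a : R}, a ∈ J →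
      IsSMulRegular M a → ∀ {rs : List R}, (∀ r ∈ rs, r ∈ J) → rs.length = k + 1 →
      IsWeaklyRegular M rs →
      ∃ rs' : List R, (∀ r ∈ rs', r ∈ J) ∧ rs'.length = k ∧ IsWeaklyRegular M (a :: rs') := by
  induction k with
  | zero =>
    intro M _ _ _ a haJ ha rs _ _ _
    exact ⟨[], by simp, rfl, IsWeaklyRegular.cons ha (IsWeaklyRegular.nil _ _)⟩
  | succ k ih =>
    intro M _ _ _ a haJ ha rs hrs hlen hreg
    obtain ⟨b, b₂, rs, rfl⟩ : ∃ b b₂ rs', rs = b :: b₂ :: rs' := by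
      match rs, hlen with
      | b :: b₂ :: rs', _ => exact ⟨b, b₂, rs', rfl⟩
    have hbJ : b ∈ J := hrs b (by simp)
    have hb₂J : b₂ ∈ J := hrs b₂ (by simp)
    obtain ⟨hb, hreg'⟩ := (isWeaklyRegular_cons_iff M _ _).1 hreg
    have hb₂ := ((isWeaklyRegular_cons_iff _ _ _).1 hreg').1
    have socle_b : ∀ m : QuotSMulTop b M, (∀ c ∈ J, c • m = 0) → m = 0 := fun m hm =>
      hb₂.right_eq_zero_of_smul (hm b₂ hb₂J)
    have socle_a := QuotSMulTop.eq_zero_of_forall_smul_eq_zero_of_isSMulRegular hbJ ha hb socle_b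
    obtain ⟨c, hcJ, hc⟩ := J.exists_isSMulRegular_of_forall_smul_eq_zero
      (M := M × QuotSMulTop a M × QuotSMulTop b M) fun m hm => by
        refine Prod.ext ?_ (Prod.ext ?_ ?_)
        · exact ha.right_eq_zero_of_smul (congrArg Prod.fst (hm a haJ))
        · exact socle_a _ fun c hc => congrArg (fun p => p.2.1) (hm c hc)
        · exact socle_b _ fun c hc => congrArg (fun p => p.2.2) (hm c hc)
    obtain ⟨hcM, hc⟩ := hc.of_prod
    obtain ⟨hca, hcb⟩ := hc.of_prod
    obtain ⟨rs₁, hrs₁, hlen₁, hreg₁⟩ := ih hcJ hcb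
      (fun r hr => hrs r (List.mem_cons_of_mem _ hr)) (by simpa using hlen) hreg'
    have hreg₂ := ((isWeaklyRegular_cons_iff _ _ _).1
      ((IsWeaklyRegular.cons hb hreg₁).swap_head hcM)).2
    obtain ⟨rs₂, hrs₂, hlen₂, hreg₃⟩ := ih haJ (ha.quotSMulTop_swap hca)
      (rs := b :: rs₁) (by simpa [hbJ] using hrs₁) (by simpa using hlen₁) hreg₂
    exact ⟨c :: rs₂, by simpa [hcJ] using hrs₂, by simpa using hlen₂,
      (IsWeaklyRegular.cons hcM hreg₃).swap_head ha⟩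

/-- Depth does not grow along a faithfully flat extension, for ideals `J` and `J'` agreeing up to
radical. -/
theorem RingTheory.Sequence.IsWeaklyRegular.exists_of_isBaseChange {S : Type*} [CommRing S]
    [Algebra R S] [Module.FaithfullyFlat R S] [IsNoetherianRing R] [IsNoetherianRing S]
    {J : Ideal R} {J' : Ideal S} (hle : J.map (algebraMap R S) ≤ J')
    (hrad : J' ≤ (J.map (algebraMap R S)).radical) {k : ℕ} :
    ∀ {M N : Type*} [AddCommGroup M] [Module R M] [Module.Finite R M] [AddCommGroup N]
      [Module R N] [Module S N] [IsScalarTower R S N] {f : M →ₗ[R] N}, IsBaseChange S f →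
      ∀ {rs : List S}, (∀ r ∈ rs, r ∈ J') → rs.length = k → IsWeaklyRegular N rs →
      ∃ rs' : List R, (∀ r ∈ rs', r ∈ J) ∧ rs'.length = k ∧ IsWeaklyRegular M rs' := by
  induction k with
  | zero => exact fun _ _ _ _ _ => ⟨[], by simp, rfl, IsWeaklyRegular.nil _ _⟩
  | succ k ih =>
    intro M N _ _ _ _ _ _ _ f hf rs hrs hlen hreg
    have : Module.Finite S N := Module.Finite.of_surjective hf.equiv.toLinearMap hf.equiv.surjective
    have hinj : Function.Injective f := by
      have h1 := Module.FaithfullyFlat.tensorProduct_mk_injective (A := R) (B := S) M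
      have : (f : M → N) = hf.equiv ∘ TensorProduct.mk R S M 1 := by
        ext x; simp
      rw [this]
      exact hf.equiv.injective.comp h1
    obtain ⟨b, rs, rfl⟩ := List.exists_cons_of_length_eq_add_one hlen
    have hb := ((isWeaklyRegular_cons_iff _ _ _).1 hreg).1
    obtain ⟨a, haJ, ha⟩ := J.exists_isSMulRegular_of_forall_smul_eq_zero (M := M) fun m hm => by
      obtain ⟨e, he⟩ := hrad (hrs b (by simp))
      refine hinj ?_
      rw [map_zero]
      refine (hb.pow e).right_eq_zero_of_smul ?_
      suffices J.map (algebraMap R S) ≤ LinearMap.ker (LinearMap.toSpanSingleton S N (f m)) from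
        this he
      refine Ideal.map_le_iff_le_comap.2 fun c hc => ?_
      change algebraMap R S c • f m = 0
      rw [algebraMap_smul, ← map_smul, hm c hc, map_zero]
    obtain ⟨rs₁, hrs₁, hlen₁, hreg₁⟩ := hreg.exists_cons_of_isSMulRegular
      (hle (Ideal.mem_map_of_mem _ haJ)) (ha.of_flat_of_isBaseChange hf) hrs hlen
    have e := (QuotSMulTop.algebraMapTensorEquivTensorQuotSMulTop a M S).symm ≪≫ₗ
      QuotSMulTop.congr ((algebraMap R S) a) hf.equiv
    have hg : IsBaseChange S <|
        e.toLinearMap.restrictScalars R ∘ₗ TensorProduct.mk R S (QuotSMulTop a M) 1 :=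
      IsBaseChange.of_equiv e (fun _ ↦ by simp)
    obtain ⟨rs₂, hrs₂, hlen₂, hreg₂⟩ :=
      ih hg hrs₁ hlen₁ ((isWeaklyRegular_cons_iff _ _ _).1 hreg₁).2
    exact ⟨a :: rs₂, by simpa [haJ] using hrs₂, by simpa using hlen₂, IsWeaklyRegular.cons ha hreg₂⟩

end Depth

section FaithfullyFlat

theorem RingHom.FaithfullyFlat.of_basis {A B ι : Type*} [CommRing A] [CommRing B] [Nontrivial B]
    (φ : A →+* B) (b : ι → B) (hli : ∀ f : ι →₀ A, f.sum (fun i a => φ a * b i) = 0 → f = 0)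
    (hspan : ∀ y : B, ∃ f : ι →₀ A, f.sum (fun i a => φ a * b i) = y) : φ.FaithfullyFlat := by
  algebraize [φ]
  rw [← RingHom.algebraMap_toAlgebra φ, RingHom.faithfullyFlat_algebraMap_iff]
  have hsum : ∀ f : ι →₀ A, Finsupp.linearCombination A b f = f.sum fun i a => φ a * b i :=
    fun f => by
      simp only [Finsupp.linearCombination_apply, Algebra.smul_def, RingHom.algebraMap_toAlgebra]
  have : Module.Free A B := .of_basis <| Module.Basis.mk (v := b)
    (linearIndependent_iff.2 fun f hf => hli f ((hsum f).symm.trans hf)) fun y _ => by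
      obtain ⟨f, hf⟩ := hspan y
      exact (Finsupp.mem_span_range_iff_exists_finsupp).2 ⟨f, by rw [← hf, ← hsum]; rfl⟩
  infer_instance

variable {A B : Type*} [CommRing A] [CommRing B] {φ : A →+* B}

theorem RingTheory.Sequence.IsRegular.quotient_map (hφ : φ.FaithfullyFlat) {I : Ideal A}
    {rs : List A} (h : IsRegular (A ⧸ I) rs) : IsRegular (B ⧸ I.map φ) (rs.map φ) := by
  algebraize [φ]
  have : Module.FaithfullyFlat A B := hφ
  exact ((Algebra.TensorProduct.quotIdealMapEquivTensorQuot B I).toLinearEquiv.isRegular_congr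
    _).2 (h.of_faithfullyFlat_of_isBaseChange (TensorProduct.isBaseChange A (A ⧸ I) B))

theorem RingTheory.Sequence.IsWeaklyRegular.exists_of_quotient_map [IsNoetherianRing A]
    [IsNoetherianRing B] (hφ : φ.FaithfullyFlat) {I J : Ideal A} {J' : Ideal B}
    (hle : J.map φ ≤ J') (hrad : J' ≤ (J.map φ).radical) {rs : List B} (hrs : ∀ r ∈ rs, r ∈ J')
    (h : IsWeaklyRegular (B ⧸ I.map φ) rs) :
    ∃ rs' : List A, (∀ r ∈ rs', r ∈ J) ∧ rs'.length = rs.length ∧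
      IsWeaklyRegular (A ⧸ I) rs' := by
  algebraize [φ]
  have : Module.FaithfullyFlat A B := hφ
  exact IsWeaklyRegular.exists_of_isBaseChange hle hrad
    (TensorProduct.isBaseChange A (A ⧸ I) B) hrs rfl
    (((Algebra.TensorProduct.quotIdealMapEquivTensorQuot B I).toLinearEquiv.isWeaklyRegular_congr
      _).1 h)

theorem RingTheory.Sequence.IsWeaklyRegular.isRegular_quotient {I J : Ideal A} (hIJ : I ≤ J)
    (hJ : J ≠ ⊤) {rs : List A} (hrs : ∀ r ∈ rs, r ∈ J) (h : IsWeaklyRegular (A ⧸ I) rs) :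
    IsRegular (A ⧸ I) rs := by
  refine ⟨h, fun htop => hJ ?_⟩
  have hle : (Ideal.ofList rs • ⊤ : Submodule A (A ⧸ I)) ≤ LinearMap.ker (Submodule.factor hIJ) :=
    Submodule.smul_le.2 fun r hr x _ => by
      obtain ⟨x, rfl⟩ := Submodule.Quotient.mk_surjective _ x
      rw [LinearMap.mem_ker, map_smul, ← Submodule.mkQ_apply, Submodule.factor_mk, ← map_smul, Submodule.mkQ_apply,
        Submodule.Quotient.mk_eq_zero]
      exact J.mul_mem_right x (Ideal.span_le.2 (fun a ha => hrs a ha) hr)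
  have h1 : (Submodule.Quotient.mk 1 : A ⧸ I) ∈ LinearMap.ker (Submodule.factor hIJ) :=
    hle (htop ▸ trivial)
  rw [LinearMap.mem_ker, ← Submodule.mkQ_apply, Submodule.factor_mk, Submodule.mkQ_apply,
    Submodule.Quotient.mk_eq_zero] at h1
  exact J.eq_top_iff_one.2 h1

end FaithfullyFlat

theorem ringKrullDim_quotient_eq_of_le_radical {A : Type*} [CommRing A] {I J : Ideal A}
    (h₁ : I ≤ J) (h₂ : J ≤ I.radical) : ringKrullDim (A ⧸ I) = ringKrullDim (A ⧸ J) := by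
  have : PrimeSpectrum.zeroLocus (I : Set A) = PrimeSpectrum.zeroLocus J :=
    (PrimeSpectrum.zeroLocus_radical I ▸ PrimeSpectrum.zeroLocus_anti_mono_ideal h₂).antisymm
      (PrimeSpectrum.zeroLocus_anti_mono_ideal h₁)
  rw [ringKrullDim_quotient, ringKrullDim_quotient, this]

namespace MvPolynomial

theorem idealOfVars_ne_top (σ K : Type*) [Field K] : idealOfVars σ K ≠ ⊤ := by
  have h : idealOfVars σ K ≤ RingHom.ker (constantCoeff (R := K) (σ := σ)) :=
    Ideal.span_le.2 (Set.range_subset_iff.2 fun i => by simp)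
  exact fun htop => RingHom.ker_ne_top (constantCoeff (R := K) (σ := σ)) (top_le_iff.1 (htop ▸ h))

theorem monomial_mem_idealOfVars {σ K : Type*} [Field K] {e : σ →₀ ℕ} (he : e ≠ 0) {c : K}
    (hc : c ≠ 0) : monomial e c ∈ idealOfVars σ K := by
  rw [← pow_one (idealOfVars σ K), monomial_mem_pow_idealOfVars_iff 1 e hc]
  exact Nat.one_le_iff_ne_zero.2 ((Finsupp.degree_eq_zero_iff e).not.2 he)

section WeightedSubstitution

variable {n : ℕ} {K : Type*} [Field K]

/-- Multiply the `j`-th exponent by `d j`. -/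
def weightedExponent (d : Fin n → ℕ) (e : Fin n →₀ ℕ) : Fin n →₀ ℕ :=
  Finsupp.equivFunOnFinite.symm fun j => d j * e j

@[simp]
theorem weightedExponent_apply (d : Fin n → ℕ) (e : Fin n →₀ ℕ) (j : Fin n) :
    weightedExponent d e j = d j * e j := rfl

variable (K) in
/-- The substitution `x_j ↦ x_j ^ d_j`. -/
def weightedSubstitution (d : Fin n → ℕ) :
    MvPolynomial (Fin n) K →+* MvPolynomial (Fin n) K :=
  (aeval fun j => (X j : MvPolynomial (Fin n) K) ^ d j).toRingHom

@[simp]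
theorem weightedSubstitution_X (d : Fin n → ℕ) (j : Fin n) :
    weightedSubstitution K d (X j) = X j ^ d j := by
  simp [weightedSubstitution]

@[simp]
theorem weightedSubstitution_monomial (d : Fin n → ℕ) (e : Fin n →₀ ℕ) (c : K) :
    weightedSubstitution K d (monomial e c) = monomial (weightedExponent d e) c := by
  rw [monomial_eq (s := weightedExponent d e), Finsupp.prod_fintype _ _ fun i => pow_zero _]
  rw [weightedSubstitution, AlgHom.toRingHom_eq_coe, AlgHom.coe_toRingHom, aeval_monomial,
    Finsupp.prod_fintype _ _ fun i => pow_zero _]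
  simp [pow_mul, algebraMap_eq]

variable {d : Fin n → ℕ}

theorem weightedExponent_add_inj {q q' r r' : Fin n →₀ ℕ} (hr : ∀ j, r j < d j)
    (hr' : ∀ j, r' j < d j) :
    weightedExponent d q + r = weightedExponent d q' + r' ↔ q = q' ∧ r = r' := by
  refine ⟨fun h => ?_, fun h => by rw [h.1, h.2]⟩
  have h' : ∀ j, d j * q j + r j = d j * q' j + r' j := fun j => DFunLike.congr_fun h j
  constructor <;> ext j
  · have := congrArg (· / d j) (h' j)
    simpa [Nat.mul_add_div (Nat.zero_lt_of_lt (hr j)), Nat.div_eq_of_lt, hr j, hr' j] using this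
  · have := congrArg (· % d j) (h' j)
    simpa [Nat.mul_add_mod, Nat.mod_eq_of_lt, hr j, hr' j] using this

theorem coeff_weightedSubstitution_mul_monomial {r r' : Fin n →₀ ℕ} (hr : ∀ j, r j < d j)
    (hr' : ∀ j, r' j < d j) (q : Fin n →₀ ℕ) (p : MvPolynomial (Fin n) K) :
    coeff (weightedExponent d q + r) (weightedSubstitution K d p * monomial r' 1) =
      if r' = r then coeff q p else 0 := by
  induction p using MvPolynomial.induction_on' with
  | monomial e c =>
    rw [weightedSubstitution_monomial, monomial_mul, mul_one, coeff_monomial, coeff_monomial]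
    simp only [weightedExponent_add_inj hr' hr, and_comm, ite_and]
  | add p₁ p₂ h₁ h₂ =>
    rw [map_add, add_mul, coeff_add, h₁, h₂, coeff_add]
    split_ifs <;> simp

theorem weightedSubstitution_faithfullyFlat (hd : ∀ j, 1 ≤ d j) :
    (weightedSubstitution K d).FaithfullyFlat := by
  refine .of_basis _ (fun r : {r : Fin n →₀ ℕ // ∀ j, r j < d j} => monomial r.1 1)
    (fun f hf => ?_) fun y => ?_
  · ext r q
    have := congrArg (coeff (weightedExponent d q + r.1)) hf
    rw [Finsupp.sum, coeff_sum] at this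
    rw [Finset.sum_congr rfl fun r' _ =>
      coeff_weightedSubstitution_mul_monomial r.2 r'.2 q (f r')] at this
    simp only [Subtype.val_inj, Finset.sum_ite_eq', coeff_zero] at this
    by_cases h : r ∈ f.support
    · simpa [h] using this
    · simp [Finsupp.notMem_support_iff.1 h]
  · induction y using MvPolynomial.induction_on' with
    | monomial e c =>
      refine ⟨Finsupp.single ⟨Finsupp.equivFunOnFinite.symm fun j => e j % d j,
        fun j => Nat.mod_lt _ (hd j)⟩
        (monomial (Finsupp.equivFunOnFinite.symm fun j => e j / d j) c), ?_⟩
      rw [Finsupp.sum_single_index (by simp), weightedSubstitution_monomial, monomial_mul, mul_one]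
      congr
      ext j
      simp [Nat.div_add_mod]
    | add p₁ p₂ h₁ h₂ =>
      obtain ⟨f₁, rfl⟩ := h₁
      obtain ⟨f₂, rfl⟩ := h₂
      exact ⟨f₁ + f₂, Finsupp.sum_add_index' (by simp) (by simp [add_mul])⟩

end WeightedSubstitution

end MvPolynomial

/-- Let `I` be a squarefree monomial ideal and `d` a positive weight on
the variables. If `I'` is generated by the monomials obtained from the minimal generators
of `I` by replacing each `x_i` with `x_i^{d_i}`, then `I` is Cohen–Macaulay iff `I'` is
Cohen–Macaulay. -/
theorem cm_iff_weighted_substitution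
    {n : ℕ} {K : Type*} [Field K] (I : Ideal (MvPolynomial (Fin n) K))
    {s : ℕ} (v : Fin s → (Fin n →₀ ℕ)) (hgen : IsMinimalMonomialGens I v)
    (hsf : ∀ a j, v a j ≤ 1)
    (d : Fin n → ℕ) (hd : ∀ j, 1 ≤ d j)
    (I' : Ideal (MvPolynomial (Fin n) K))
    (hI' : I' = Ideal.span {f | ∃ a : Fin s,
      f = monomial (Finsupp.equivFunOnFinite.symm fun j => d j * v a j) (1 : K)}) :
    IsCohenMacaulayIdeal I ↔ IsCohenMacaulayIdeal I' := by
  have hI : I = Ideal.span (Set.range fun a => monomial (v a) (1 : K)) := hgen.1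
  have hmem : ∀ a, monomial (v a) (1 : K) ∈ I := fun a => hI ▸ Ideal.subset_span ⟨a, rfl⟩
  have hmem' : ∀ a, monomial (weightedExponent d (v a)) (1 : K) ∈ I' := fun a =>
    hI' ▸ Ideal.subset_span ⟨a, rfl⟩
  have hmap : I.map (weightedSubstitution K d) = I' := by
    rw [hI, hI', Ideal.map_span, ← Set.range_comp]
    congr 1
    ext f
    simp [weightedExponent, eq_comm]
  have hI'I : I' ≤ I := by
    rw [hI', Ideal.span_le]
    rintro _ ⟨a, rfl⟩
    exact I.mem_of_dvd (monomial_dvd_monomial.2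
      ⟨.inr fun j => Nat.le_mul_of_pos_left _ (hd j), one_dvd _⟩) (hmem a)
  have hrad : I ≤ I'.radical := by
    rw [hI, Ideal.span_le]
    rintro _ ⟨a, rfl⟩
    refine ⟨∑ j, d j, ?_⟩
    rw [monomial_pow, one_pow]
    exact I'.mem_of_dvd (monomial_dvd_monomial.2
      ⟨.inr fun j => Nat.mul_le_mul_right _
        (Finset.single_le_sum (fun _ _ => Nat.zero_le _) (Finset.mem_univ j)), one_dvd _⟩)
      (hmem' a)
  have hdim := ringKrullDim_quotient_eq_of_le_radical hI'I hrad
  have hflat := weightedSubstitution_faithfullyFlat (K := K) hd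
  have hvars : (idealOfVars (Fin n) K).map (weightedSubstitution K d) ≤ idealOfVars (Fin n) K := by
    rw [Ideal.map_span, Ideal.span_le]
    rintro _ ⟨_, ⟨j, rfl⟩, rfl⟩
    rw [weightedSubstitution_X]
    exact Ideal.pow_mem_of_mem _ (Ideal.subset_span (Set.mem_range_self j)) _ (hd j)
  constructor
  · rintro ⟨rs, hrs, hreg, hlen⟩
    refine ⟨rs.map (weightedSubstitution K d), fun f hf => ?_, hmap ▸ hreg.quotient_map hflat, ?_⟩
    · obtain ⟨g, hg, rfl⟩ := List.mem_map.1 hf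
      exact hvars (Ideal.mem_map_of_mem _ (hrs g hg))
    · rw [List.length_map, hlen, hdim]
  · rintro ⟨rs, hrs, hreg, hlen⟩
    have hIvars : I ≤ idealOfVars (Fin n) K := by
      rw [hI, Ideal.span_le]
      rintro _ ⟨a, rfl⟩
      refine monomial_mem_idealOfVars (fun ha => ?_) one_ne_zero
      have h1 := hrad (hmem a)
      rw [ha, ← C_apply, C_1, ← Ideal.eq_top_iff_one, Ideal.radical_eq_top] at h1
      have := hreg.nontrivial
      exact Submodule.Quotient.nontrivial_iff.1 this h1
    have hvars' : idealOfVars (Fin n) K ≤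
        ((idealOfVars (Fin n) K).map (weightedSubstitution K d)).radical := by
      refine Ideal.span_le.2 ?_
      rintro _ ⟨j, rfl⟩
      refine ⟨d j, ?_⟩
      rw [← weightedSubstitution_X]
      exact Ideal.mem_map_of_mem _ (Ideal.subset_span ⟨j, rfl⟩)
    obtain ⟨rs', hrs', hlen', hreg'⟩ := IsWeaklyRegular.exists_of_quotient_map hflat (I := I)
      hvars hvars' hrs (hmap.symm ▸ hreg.toIsWeaklyRegular)
    exact ⟨rs', hrs', hreg'.isRegular_quotient hIvars (idealOfVars_ne_top _ _) hrs',
      by rw [hlen', hlen, hdim]⟩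
end
end
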